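/- arXiv:2212.09285 — 4 statements merged into one kernel-verified Lean document; each statement's English description precedes it below -/
import Mathlib

section
/- There are absolute constants K and c such that for every n, every f ∈ ℱ_n, and every s ≥ n: if f is not computable by any Boolean circuit over {¬, ∧₂, ∨₂} of size at most K·s³, then there exists a set F₀ of semi-filters F ⊆ 𝒫(U) with v(F) ∈ V such that |F₀| ≤ 2^{c·s·|U|} and ρ_{F₀}(f) ≥ s. -/
open scoped Classical ENNReal

noncomputable section

/-- Boolean functions on `{0,1}^n`. -/
abbrev BF (n : ℕ) := (Fin n → Bool) → Bool

/-- A connective: an arity `m` together with a function `{0,1}^m → {0,1}`. -/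
abbrev Conn := Σ m : ℕ, (Fin m → Bool) → Bool

/-- A connective is commutative if it is invariant under permutations of its inputs. -/
def Conn.Comm (c : Conn) : Prop :=
  ∀ (π : Equiv.Perm (Fin c.1)) (v : Fin c.1 → Bool), c.2 (v ∘ π) = c.2 v

/-- A Boolean circuit (in straight-line / DAG form) with `n` inputs over the
set of connectives `S`.  Gate `i` may be wired to input variables, constants,
or earlier gates `j < i`; the size is the number of gates. -/
structure Circuit (n : ℕ) (S : Set Conn) where
  size : ℕ
  conn : Fin size → Conn
  conn_mem : ∀ i, conn i ∈ S
  wires : (i : Fin size) → Fin (conn i).1 → (Fin n ⊕ (Bool ⊕ Fin i.val))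
  output : Fin n ⊕ (Bool ⊕ Fin size)

namespace Circuit

variable {n : ℕ} {S : Set Conn}

/-- The value computed at gate `i` on input `x`. -/
def gateVal (C : Circuit n S) (x : Fin n → Bool) : ℕ → Bool
  | i =>
    if h : i < C.size then
      (C.conn ⟨i, h⟩).2 (fun k =>
        match C.wires ⟨i, h⟩ k with
        | Sum.inl v => x v
        | Sum.inr (Sum.inl b) => b
        | Sum.inr (Sum.inr j) => C.gateVal x j.val)
    else false
termination_by i => i
decreasing_by exact j.isLt

/-- Reading a port (input variable, constant, or gate). -/
def readPort (C : Circuit n S) (x : Fin n → Bool) : (Fin n ⊕ (Bool ⊕ Fin C.size)) → Bool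
  | Sum.inl v => x v
  | Sum.inr (Sum.inl b) => b
  | Sum.inr (Sum.inr g) => C.gateVal x g.val

/-- The function computed by the circuit. -/
def eval (C : Circuit n S) (x : Fin n → Bool) : Bool := C.readPort x C.output

def Computes (C : Circuit n S) (f : BF n) : Prop := ∀ x, C.eval x = f x

/-- The depth of gate `i` (number of edges on the longest path to an input or constant). -/
def gateDepth (C : Circuit n S) : ℕ → ℕ
  | i =>
    if h : i < C.size then
      1 + Finset.univ.sup (fun k =>
        match C.wires ⟨i, h⟩ k with
        | Sum.inl _ => 0
        | Sum.inr (Sum.inl _) => 0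
        | Sum.inr (Sum.inr j) => C.gateDepth j.val)
    else 0
termination_by i => i
decreasing_by exact j.isLt

/-- The depth of a circuit. -/
def depth (C : Circuit n S) : ℕ :=
  match C.output with
  | Sum.inl _ => 0
  | Sum.inr (Sum.inl _) => 0
  | Sum.inr (Sum.inr g) => C.gateDepth g.val

/-- The input variables of `C` are among `{x_j : j ∈ J}`. -/
def UsesVars (C : Circuit n S) (J : Set (Fin n)) : Prop :=
  (∀ (i : Fin C.size) (k : Fin (C.conn i).1) (v : Fin n), C.wires i k = Sum.inl v → v ∈ J) ∧
  (∀ v : Fin n, C.output = Sum.inl v → v ∈ J)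

end Circuit

/-- The size of the smallest circuit from the class `CC` computing `f`
(`⊤` if there is none). -/
def sizeIn {n : ℕ} {S : Set Conn} (CC : Set (Circuit n S)) (f : BF n) : ℕ∞ :=
  sInf {t : ℕ∞ | ∃ C ∈ CC, C.Computes f ∧ t = (C.size : ℕ∞)}

/-- Negation, binary conjunction and binary disjunction. -/
abbrev notConn : Conn := ⟨1, fun v => !(v 0)⟩
abbrev andConn : Conn := ⟨2, fun v => v 0 && v 1⟩
abbrev orConn : Conn := ⟨2, fun v => v 0 || v 1⟩

/-- The connectives `{¬, ∧₂, ∨₂}`. -/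
def S3 : Set Conn := {notConn, andConn, orConn}

/-- Unbounded fan-in conjunction and disjunction. -/
abbrev bigAnd (a : ℕ) : Conn := ⟨a, fun v => decide (∀ i, v i = true)⟩
abbrev bigOr (a : ℕ) : Conn := ⟨a, fun v => decide (∃ i, v i = true)⟩

/-- The connectives `∪_{a ≥ 2} {¬, ∧_a, ∨_a}`. -/
def Sunb : Set Conn := {c | c = notConn ∨ ∃ a : ℕ, 2 ≤ a ∧ (c = bigAnd a ∨ c = bigOr a)}

/-- The connectives `∪_{2 ≤ a ≤ t} {¬, ∧_a, ∨_a}`. -/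
def Sbdd (t : ℕ) : Set Conn :=
  {c | c = notConn ∨ ∃ a : ℕ, 2 ≤ a ∧ a ≤ t ∧ (c = bigAnd a ∨ c = bigOr a)}

/-- A legitimate model of order `n` of the circuit class with connectives `S`:
a set `M` of Boolean functions containing the constants and the variables,
together with a commutative approximating operation `∘̄ : M^m → M` for each
connective `∘ ∈ S` of arity `m`. -/
structure LegitModel (n : ℕ) (S : Set Conn) where
  M : Set (BF n)
  const_mem : ∀ b : Bool, (fun _ => b) ∈ M
  var_mem : ∀ i : Fin n, (fun x => x i) ∈ M
  approx : (c : Conn) → c ∈ S → ((Fin c.1 → M) → M)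
  approx_comm : ∀ (c : Conn) (hc : c ∈ S) (π : Equiv.Perm (Fin c.1)) (fs : Fin c.1 → M),
      approx c hc (fs ∘ π) = approx c hc fs

namespace LegitModel

variable {n : ℕ} {S : Set Conn}

/-- The error set `δ_∘(f_1,…,f_m) = ∘(f_1,…,f_m) ⊕ ∘̄(f_1,…,f_m)`. -/
def errSet (Mdl : LegitModel n S) (c : Conn) (hc : c ∈ S) (fs : Fin c.1 → Mdl.M) :
    Set (Fin n → Bool) :=
  {x | c.2 (fun k => (fs k).1 x) ≠ (Mdl.approx c hc fs).1 x}

/-- The collection `Δ` of all error sets of the model. -/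
def Delta (Mdl : LegitModel n S) : Set (Set (Fin n → Bool)) :=
  {δ | ∃ c : Conn, ∃ hc : c ∈ S, ∃ fs : Fin c.1 → Mdl.M, δ = Mdl.errSet c hc fs}

/-- `f ⊕ g` can be covered by `t` error sets, for some `g ∈ M`. -/
def CoversWith (Mdl : LegitModel n S) (f : BF n) (t : ℕ) : Prop :=
  ∃ g, g ∈ Mdl.M ∧ ∃ δs : Fin t → Set (Fin n → Bool),
    (∀ i, δs i ∈ Mdl.Delta) ∧ ∀ x, f x ≠ g x → ∃ i, x ∈ δs i

/-- The distance `ρ(f, M)`: the minimal number of error sets needed to cover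
`f ⊕ g` for some `g ∈ M` (`⊤` if impossible). -/
def rho (Mdl : LegitModel n S) (f : BF n) : ℕ∞ :=
  sInf {t : ℕ∞ | ∃ k : ℕ, t = (k : ℕ∞) ∧ Mdl.CoversWith f k}

/-- The approximating operation for negation is exact negation (`¬̄ := ¬`). -/
def NegExact (Mdl : LegitModel n S) : Prop :=
  ∀ (hc : notConn ∈ S) (fs : Fin 1 → Mdl.M),
    (Mdl.approx notConn hc fs).1 = fun x => !((fs 0).1 x)

end LegitModel

namespace Circuit

/-- The approximator of gate `i`, where the circuit inputs are substituted by
functions `σ` from the model. -/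
def gateApproxWith {n n' : ℕ} {S : Set Conn} (Mdl : LegitModel n S) (C : Circuit n' S)
    (σ : Fin n' → Mdl.M) : ℕ → Mdl.M
  | i =>
    if h : i < C.size then
      Mdl.approx (C.conn ⟨i, h⟩) (C.conn_mem ⟨i, h⟩) (fun k =>
        match C.wires ⟨i, h⟩ k with
        | Sum.inl v => σ v
        | Sum.inr (Sum.inl b) => ⟨fun _ => b, Mdl.const_mem b⟩
        | Sum.inr (Sum.inr j) => gateApproxWith Mdl C σ j.val)
    else ⟨fun _ => false, Mdl.const_mem false⟩
termination_by i => i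
decreasing_by exact j.isLt

/-- The function computed by the approximating circuit `C̄`, with circuit inputs
substituted by functions `σ` from the model. -/
def approxEvalWith {n n' : ℕ} {S : Set Conn} (Mdl : LegitModel n S) (C : Circuit n' S)
    (σ : Fin n' → Mdl.M) : Mdl.M :=
  match C.output with
  | Sum.inl v => σ v
  | Sum.inr (Sum.inl b) => ⟨fun _ => b, Mdl.const_mem b⟩
  | Sum.inr (Sum.inr g) => gateApproxWith Mdl C σ g.val

/-- The function computed by the approximating circuit `C̄` (inputs are the variables). -/
def approxEval {n : ℕ} {S : Set Conn} (Mdl : LegitModel n S) (C : Circuit n S) : Mdl.M :=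
  approxEvalWith Mdl C (fun i => ⟨fun x => x i, Mdl.var_mem i⟩)

end Circuit

namespace LegitModel

variable {n : ℕ} {S : Set Conn}

/-- Depth-`d` covering: as `CoversWith`, but the approximator `g` is the approximator of a
circuit of depth at most `d` and the input functions of the covering error sets are
approximators of circuits of depth at most `d - 1`. -/
def CoversWithD (Mdl : LegitModel n S) (f : BF n) (d t : ℕ) : Prop :=
  ∃ D : Circuit n S, D.depth ≤ d ∧
    ∃ δs : Fin t → Set (Fin n → Bool),
      (∀ i, ∃ c : Conn, ∃ hc : c ∈ S, ∃ fs : Fin c.1 → Mdl.M,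
        (∀ j, ∃ Cj : Circuit n S, Cj.depth ≤ d - 1 ∧ Circuit.approxEval Mdl Cj = fs j) ∧
        δs i = Mdl.errSet c hc fs) ∧
      ∀ x, f x ≠ (Circuit.approxEval Mdl D).1 x → ∃ i, x ∈ δs i

/-- The `d`-depth distance `ρ_d(f, M)`. -/
def rhoD (Mdl : LegitModel n S) (d : ℕ) (f : BF n) : ℕ∞ :=
  sInf {t : ℕ∞ | ∃ k : ℕ, t = (k : ℕ∞) ∧ Mdl.CoversWithD f d k}

/-- `0`-projectivity: the approximator of a circuit depends only on the variables
the circuit uses. -/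
def ZeroProjective (Mdl : LegitModel n S) : Prop :=
  ∀ (C : Circuit n S) (J : Set (Fin n)), C.UsesVars J →
    ∀ z y : Fin n → Bool, (∀ j ∈ J, z j = y j) →
      (Circuit.approxEval Mdl C).1 z = (Circuit.approxEval Mdl C).1 y

/-- Projectivity: the approximator of a circuit with inputs substituted by
`f_1, …, f_m ∈ M` depends only on the values `f_1(x), …, f_m(x)`. -/
def Projective (Mdl : LegitModel n S) : Prop :=
  ∀ (m : ℕ) (C : Circuit m S) (σ : Fin m → Mdl.M) (z y : Fin n → Bool),
    (∀ i, (σ i).1 z = (σ i).1 y) →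
      (Circuit.approxEvalWith Mdl C σ).1 z = (Circuit.approxEvalWith Mdl C σ).1 y

end LegitModel

/-- `Pr[𝐱 ∈ A]` for a distribution `p` on `{0,1}^n`. -/
def prOf {n : ℕ} (p : (Fin n → Bool) → ℝ) (A : Set (Fin n → Bool)) : ℝ :=
  ∑ x, A.indicator p x

/-- `p` is a (finitely supported) probability distribution on `{0,1}^n`. -/
def IsDistrib {n : ℕ} (p : (Fin n → Bool) → ℝ) : Prop :=
  (∀ x, 0 ≤ p x) ∧ (∑ x, p x) = 1

/-- The probabilistic distance `ρ(f, M, 𝐱) = min_{g ∈ M} Pr[f(𝐱) ≠ g(𝐱)] / d`. -/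
def LegitModel.rhoProb {n : ℕ} {S : Set Conn} (Mdl : LegitModel n S) (f : BF n)
    (p : (Fin n → Bool) → ℝ) (d : ℝ) : ℝ :=
  sInf {r : ℝ | ∃ g ∈ Mdl.M, r = prOf p {x | f x ≠ g x} / d}

/-- The variable `x_i` is essential for `f`. -/
def Essential {n : ℕ} (f : BF n) (i : Fin n) : Prop :=
  ∃ x, f (Function.update x i (!(x i))) ≠ f x

/-- The number `n₀` of essential variables of `f`. -/
def essCount {n : ℕ} (f : BF n) : ℕ := {i | Essential f i}.ncard

/-- An oracle circuit: a circuit over arbitrary (possibly noncommutative) connectives,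
together with a set of at most `k` designated oracle gates of arity `m`; all other
gates use connectives from `S`. -/
structure OracleCircuit (n : ℕ) (S : Set Conn) (k m : ℕ) where
  base : Circuit n Set.univ
  oracleGates : Finset (Fin base.size)
  card_le : oracleGates.card ≤ k
  arity_eq : ∀ i ∈ oracleGates, (base.conn i).1 = m
  conn_mem : ∀ i, i ∉ oracleGates → base.conn i ∈ S

/-- An oracle circuit whose `k` oracle gates of arity `m` are at the bottom, with
inputs among the literals `x_1, ¬x_1, …, x_n, ¬x_n`: each oracle `i` reads the
literals described by `lits i`, and the top circuit over `S` has the `n` variables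
and the `k` oracle outputs as inputs.  Its size is `top.size + k`. -/
structure BottomOracleCircuit (n k m : ℕ) (S : Set Conn) where
  oracles : Fin k → (Fin m → Bool) → Bool
  lits : Fin k → Fin m → Fin n × Bool
  top : Circuit (n + k) S

/-- Evaluation of a bottom-oracle circuit. -/
def BottomOracleCircuit.eval {n k m : ℕ} {S : Set Conn} (C : BottomOracleCircuit n k m S)
    (x : Fin n → Bool) : Bool :=
  C.top.eval (Fin.append x (fun i => C.oracles i (fun j => x (C.lits i j).1 == (C.lits i j).2)))

/-- Ceiling division `⌈a / b⌉` on natural numbers. -/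
def natCeilDiv (a b : ℕ) : ℕ := (a + b - 1) / b

end

noncomputable section

/-- The zero set `U = f⁻¹(0)`. -/
def zeros {n : ℕ} (f : BF n) : Set (Fin n → Bool) := {x | f x = false}

/-- The one set `V = f⁻¹(1)`. -/
def ones {n : ℕ} (f : BF n) : Set (Fin n → Bool) := {x | f x = true}

/-- `F` is a semi-filter on `𝒫(U)`: it contains `U`, does not contain `∅`, and is
monotone (upward closed within subsets of `U`). -/
def IsSemiFilter {α : Type*} (U : Set α) (F : Set (Set α)) : Prop :=
  (∀ A ∈ F, A ⊆ U) ∧ (∅ : Set α) ∉ F ∧ U ∈ F ∧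
    ∀ A B : Set α, A ∈ F → A ⊆ B → B ⊆ U → B ∈ F

/-- The pair `P = (A, B)` covers `F` (i.e. `F` does not preserve `(A, B)`). -/
def CoversPair {α : Type*} (F : Set (Set α)) (P : Set α × Set α) : Prop :=
  P.1 ∈ F ∧ P.2 ∈ F ∧ P.1 ∩ P.2 ∉ F

/-- `[[x_i]]` resp. `[[¬x_i]]` relativized to `W`: the set of `x ∈ W` whose `i`-th bit is `b`. -/
def litSet {n : ℕ} (W : Set (Fin n → Bool)) (i : Fin n) (b : Bool) : Set (Fin n → Bool) :=
  {x | x i = b} ∩ W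

/-- `v` is the string `v(F)`: `v(F)_i = F([[x_i]]) ≠ F([[¬x_i]])`. -/
def HasV {n : ℕ} (W : Set (Fin n → Bool)) (F : Set (Set (Fin n → Bool)))
    (v : Fin n → Bool) : Prop :=
  ∀ i, (v i = true ↔ litSet W i true ∈ F) ∧
    ¬(litSet W i true ∈ F ↔ litSet W i false ∈ F)

/-- The fusion distance `ρ_{F₀}(f)`: the minimal number of pairs of subsets of `W`
covering every semi-filter in `F₀`. -/
def rhoFus {n : ℕ} (W : Set (Fin n → Bool)) (F0 : Set (Set (Set (Fin n → Bool)))) : ℕ∞ :=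
  sInf {t : ℕ∞ | ∃ k : ℕ, t = (k : ℕ∞) ∧
    ∃ P : Fin k → Set (Fin n → Bool) × Set (Fin n → Bool),
      (∀ i, (P i).1 ⊆ W ∧ (P i).2 ⊆ W) ∧ ∀ F ∈ F0, ∃ i, CoversPair F (P i)}

/-- A `d`-semifilter `F = (F⁰, …, F^d)` on `𝒫(U)`. -/
def IsDSemifilter {α : Type*} (U : Set α) (d : ℕ) (F : ℕ → Set (Set α)) : Prop :=
  (∀ k ≤ d, ∀ A ∈ F k, A ⊆ U) ∧
  (∀ k < d, F k ⊆ F (k + 1)) ∧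
  (∅ : Set α) ∉ F d ∧ U ∈ F 0 ∧
  ∀ k, 1 ≤ k → k ≤ d → ∀ A B : Set α, B ∈ F (k - 1) → B ⊆ A → A ⊆ U → A ∈ F k

/-- The tuple `A` `k`-covers the `d`-semifilter `F`. -/
def KCovers {α : Type*} {t : ℕ} (F : ℕ → Set (Set α)) (k : ℕ) (A : Fin t → Set α) : Prop :=
  (∀ i, A i ∈ F (k - 1)) ∧ (⋂ i, A i) ∉ F k

/-- The constant-depth fusion distance `ρ_{F₀,d,t}(f)`: the minimal number of `t`-tuples
of subsets of `W` such that every `(d-1)`-semifilter in `F₀` is `k`-covered by one of the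
tuples for some `1 ≤ k < d`. -/
def rhoDFus {n : ℕ} (W : Set (Fin n → Bool)) (d t : ℕ)
    (F0 : Set (ℕ → Set (Set (Fin n → Bool)))) : ℕ∞ :=
  sInf {r : ℕ∞ | ∃ a : ℕ, r = (a : ℕ∞) ∧
    ∃ P : Fin a → (Fin t → Set (Fin n → Bool)),
      (∀ i j, P i j ⊆ W) ∧ ∀ F ∈ F0, ∃ i, ∃ k, 1 ≤ k ∧ k < d ∧ KCovers F k (P i)}

end

noncomputable section

namespace Fus

/-- read a port from a sequence of functions -/
def readp {n : ℕ} (h : ℕ → BF n) (x : Fin n → Bool) {m : ℕ} : (Fin n ⊕ (Bool ⊕ Fin m)) → Bool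
  | Sum.inl v => x v
  | Sum.inr (Sum.inl b) => b
  | Sum.inr (Sum.inr j) => h j.val x

def GateOK {n : ℕ} (h : ℕ → BF n) (i : ℕ) : Prop :=
  ∃ c ∈ S3, ∃ w : Fin c.1 → (Fin n ⊕ (Bool ⊕ Fin i)), ∀ x, h i x = c.2 (fun k => readp h x (w k))

/-- all functions in `G` are simultaneously computed with `k` gates -/
def CC {n : ℕ} (k : ℕ) (G : Set (BF n)) : Prop :=
  ∃ h : ℕ → BF n, (∀ i < k, GateOK h i) ∧
    ∀ g ∈ G, ∃ p : Fin n ⊕ (Bool ⊕ Fin k), ∀ x, readp h x p = g x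

theorem readp_congr {n : ℕ} (h h' : ℕ → BF n) (x : Fin n → Bool) {m : ℕ}
    (hh : ∀ i < m, h i = h' i) (p : Fin n ⊕ (Bool ⊕ Fin m)) : readp h x p = readp h' x p := by
  rcases p with v | b | j
  · rfl
  · rfl
  · simp only [readp]; rw [hh j.val j.isLt]

theorem CC.circuit {n k : ℕ} {G : Set (BF n)} (H : CC k G) {f : BF n} (hf : f ∈ G) :
    ∃ C : Circuit n S3, C.size = k ∧ C.Computes f := by
  obtain ⟨h, hg, hG⟩ := H
  obtain ⟨p, hp⟩ := hG f hf
  have hg' : ∀ i : Fin k, GateOK h i.val := fun i => hg i.val i.isLt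
  choose c hc w hw using hg'
  let C : Circuit n S3 := ⟨k, c, hc, w, p⟩
  refine ⟨C, rfl, ?_⟩
  have key : ∀ x i, i < k → C.gateVal x i = h i x := by
    intro x i
    induction i using Nat.strong_induction_on with
    | _ i ih =>
      intro hi
      rw [Circuit.gateVal]
      rw [dif_pos (show i < C.size from hi)]
      rw [hw ⟨i, hi⟩ x]
      show (c ⟨i, hi⟩).2 _ = _
      refine congrArg _ ?_
      funext q
      change _ = readp h x (C.wires ⟨i, hi⟩ q)
      rcases C.wires ⟨i, hi⟩ q with v | b | j
      · rfl
      · rfl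
      · simp only [readp]
        exact ih j.val j.isLt (lt_trans j.isLt hi)
  intro x
  rw [← hp x]
  show C.readPort x p = _
  rcases p with v | b | j
  · rfl
  · rfl
  · exact key x j.val j.isLt

theorem CC.anti {n k : ℕ} {G G' : Set (BF n)} (H : CC k G) (hG : G' ⊆ G) : CC k G' := by
  obtain ⟨h, h1, h2⟩ := H
  exact ⟨h, h1, fun g hg => h2 g (hG hg)⟩

def liftp {n a b : ℕ} (hab : a ≤ b) : (Fin n ⊕ (Bool ⊕ Fin a)) → (Fin n ⊕ (Bool ⊕ Fin b)) :=
  Sum.map id (Sum.map id (Fin.castLE hab))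

theorem readp_liftp {n a b : ℕ} (hab : a ≤ b) (h : ℕ → BF n) (x) (p) :
    readp h x (liftp hab p) = readp h x p := by
  rcases p with v | b | j <;> rfl

theorem CC.gate {n k : ℕ} {G : Set (BF n)} (H : CC k G) (c : Conn) (hc : c ∈ S3)
    (gs : Fin c.1 → BF n) (hgs : ∀ q, gs q ∈ G) :
    CC (k + 1) (insert (fun x => c.2 (fun q => gs q x)) G) := by
  obtain ⟨h, h1, h2⟩ := H
  have hgs' : ∀ q, ∃ p : Fin n ⊕ (Bool ⊕ Fin k), ∀ x, readp h x p = gs q x := fun q => h2 _ (hgs q)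
  choose w hw using hgs'
  set g : BF n := fun x => c.2 (fun q => gs q x) with hgdef
  have hu : ∀ i < k, h i = Function.update h k g i := fun i hi => by
    rw [Function.update_of_ne (ne_of_lt hi)]
  refine ⟨Function.update h k g, ?_, ?_⟩
  · intro i hi
    rcases Nat.lt_succ_iff_lt_or_eq.1 hi with hi | rfl
    · obtain ⟨c', hc', w', hw'⟩ := h1 i hi
      refine ⟨c', hc', w', fun x => ?_⟩
      rw [← hu i hi, hw' x]
      refine congrArg _ ?_
      funext q
      exact readp_congr _ _ _ (fun j hj => hu j (lt_trans hj hi)) _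
    · refine ⟨c, hc, w, fun x => ?_⟩
      rw [Function.update_self]
      simp only [hgdef]
      refine congrArg _ ?_
      funext q
      rw [← hw q x]
      exact readp_congr _ _ _ hu _
  · intro g' hg'
    rcases hg' with rfl | hg'
    · refine ⟨Sum.inr (Sum.inr ⟨k, Nat.lt_succ_self k⟩), fun x => ?_⟩
      simp only [readp, Function.update_self]
    · obtain ⟨p, hp⟩ := h2 g' hg'
      refine ⟨liftp (Nat.le_succ k) p, fun x => ?_⟩
      rw [readp_liftp, ← hp x]
      exact (readp_congr _ _ _ hu _).symm

theorem CC.mono {n k k' : ℕ} {G : Set (BF n)} (H : CC k G) (hk : k ≤ k') : CC k' G := by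
  induction hk with
  | refl => exact H
  | @step m _ ih =>
    have h0 : CC m (insert (fun _ => false) G) := by
      obtain ⟨h, h1, h2⟩ := ih
      refine ⟨h, h1, fun g hg => ?_⟩
      rcases hg with rfl | hg
      · exact ⟨Sum.inr (Sum.inl false), fun x => rfl⟩
      · exact h2 g hg
    exact (h0.gate notConn (by simp [S3]) (fun _ _ => false) (fun _ => Set.mem_insert _ _)).anti
      (fun g hg => Set.mem_insert_of_mem _ (Set.mem_insert_of_mem _ hg))

/-- `g` costs `c` gates relative to `G` -/
def Cst {n : ℕ} (G : Set (BF n)) (c : ℕ) (g : BF n) : Prop :=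
  ∀ k G', G ⊆ G' → CC k G' → CC (k + c) (insert g G')

theorem Cst.of_mem {n : ℕ} {G : Set (BF n)} {g : BF n} (hg : g ∈ G) : Cst G 0 g := by
  intro k G' hG H
  rwa [Set.insert_eq_of_mem (hG hg)]

theorem Cst.mono {n a b : ℕ} {G : Set (BF n)} {g : BF n} (h : Cst G a g) (hab : a ≤ b) :
    Cst G b g := fun k G' hG H => (h k G' hG H).mono (by omega)

theorem Cst.bin {n a b : ℕ} {G : Set (BF n)} {g h : BF n} (hg : Cst G a g) (hh : Cst G b h)
    (c : (Fin 2 → Bool) → Bool) (hc : (⟨2, c⟩ : Conn) ∈ S3) :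
    Cst G (a + b + 1) (fun x => c ![g x, h x]) := by
  intro k G' hG H
  have h1 := hg k G' hG H
  have h2 := hh _ _ (hG.trans (Set.subset_insert _ _)) h1
  have h3 := h2.gate ⟨2, c⟩ hc ![g, h] (by
    intro q
    change Fin 2 at q
    fin_cases q
    · exact Set.mem_insert_of_mem _ (Set.mem_insert _ _)
    · exact Set.mem_insert _ _)
  have e : (fun x => c ![g x, h x]) = (fun x => c (fun q => ![g, h] q x)) := by
    funext x
    congr 1
    funext q
    fin_cases q <;> rfl
  rw [e]
  refine (h3.mono (by omega)).anti ?_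
  exact Set.insert_subset_insert ((Set.subset_insert _ _).trans (Set.subset_insert _ _))

theorem Cst.and {n a b : ℕ} {G : Set (BF n)} {g h : BF n} (hg : Cst G a g) (hh : Cst G b h) :
    Cst G (a + b + 1) (fun x => g x && h x) :=
  hg.bin hh (fun v => v 0 && v 1) (by simp [S3])

theorem Cst.or {n a b : ℕ} {G : Set (BF n)} {g h : BF n} (hg : Cst G a g) (hh : Cst G b h) :
    Cst G (a + b + 1) (fun x => g x || h x) :=
  hg.bin hh (fun v => v 0 || v 1) (by simp [S3])

theorem Cst.not {n : ℕ} {G : Set (BF n)} {g : BF n} (hg : g ∈ G) :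
    Cst G 1 (fun x => !(g x)) := by
  intro k G' hG H
  exact H.gate notConn (by simp [S3]) (fun _ => g) (fun _ => hG hg)

def orl {n : ℕ} (gs : List (BF n)) : BF n := fun x => gs.any (fun g => g x)

theorem Cst.orl {n c : ℕ} {G : Set (BF n)} (hG : (fun _ => false) ∈ G) (gs : List (BF n))
    (h : ∀ g ∈ gs, Cst G c g) : Cst G (gs.length * (c + 1)) (orl gs) := by
  induction gs with
  | nil => exact (Cst.of_mem hG).mono (by simp)
  | cons g gs ih =>
    have h1 := (h g (by simp)).or (ih (fun g' hg' => h g' (by simp [hg'])))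
    refine Cst.mono h1 ?_
    simp only [List.length_cons]
    ring_nf
    omega

theorem CC.many {n k c : ℕ} {ι : Type} {G : Set (BF n)} (H : CC k G) (ts : List ι) (t : ι → BF n)
    (h : ∀ i, Cst G c (t i)) : CC (k + ts.length * c) (G ∪ {g | ∃ i ∈ ts, g = t i}) := by
  induction ts with
  | nil => simpa using H
  | cons i ts ih =>
    have h1 := h i _ _ Set.subset_union_left ih
    refine (h1.mono (by simp only [List.length_cons]; ring_nf; omega)).anti ?_
    rintro g (hg | ⟨j, hj, rfl⟩)
    · exact Or.inr (Or.inl hg)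
    · rcases List.mem_cons.1 hj with rfl | hj
      · exact Or.inl rfl
      · exact Or.inr (Or.inr ⟨j, hj, rfl⟩)

section constr

variable {n s : ℕ} (U : Set (Fin n → Bool)) (P : Fin s → Set (Fin n → Bool) × Set (Fin n → Bool))

def inL (d : Fin s → BF n) (A : Set (Fin n → Bool)) : List (BF n) :=
  (if U ⊆ A then fun _ => true else fun _ => false) ::
  ((List.finRange n).map (fun j => if litSet U j true ⊆ A then (fun x => x j) else fun _ => false) ++
  ((List.finRange n).map (fun j => if litSet U j false ⊆ A then (fun x => !(x j)) else fun _ => false)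
  ++ (List.finRange s).map (fun i => if (P i).1 ∩ (P i).2 ⊆ A then d i else fun _ => false)))

def inF (d : Fin s → BF n) (A : Set (Fin n → Bool)) : BF n := orl (inL U P d A)

theorem inF_iff (d : Fin s → BF n) (A : Set (Fin n → Bool)) (x) :
    inF U P d A x = true ↔ U ⊆ A ∨ (∃ j, litSet U j (x j) ⊆ A) ∨
      ∃ i, d i x = true ∧ (P i).1 ∩ (P i).2 ⊆ A := by
  have e : ∀ (p : Prop) [Decidable p] (g : BF n),
      ((if p then g else fun _ => false) x = true) ↔ (p ∧ g x = true) := by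
    intro p _ g
    split_ifs with h <;> simp [h]
  simp only [inF, orl, inL, List.any_cons, List.any_append, Bool.or_eq_true, List.any_eq_true,
    List.mem_map, List.mem_finRange, true_and, exists_exists_eq_and, e]
  constructor
  · rintro (h | ⟨j, h1, h2⟩ | ⟨j, h1, h2⟩ | ⟨i, h1, h2⟩)
    · exact Or.inl h.1
    · exact Or.inr (Or.inl ⟨j, by rwa [h2]⟩)
    · exact Or.inr (Or.inl ⟨j, by simp only [Bool.not_eq_true'] at h2; rwa [h2]⟩)
    · exact Or.inr (Or.inr ⟨i, h2, h1⟩)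
  · rintro (h | ⟨j, h⟩ | ⟨i, h1, h2⟩)
    · exact Or.inl ⟨h, trivial⟩
    · rcases hx : x j with _ | _
      · rw [hx] at h
        exact Or.inr (Or.inr (Or.inl ⟨j, h, by simp [hx]⟩))
      · rw [hx] at h
        exact Or.inr (Or.inl ⟨j, h, hx⟩)
    · exact Or.inr (Or.inr (Or.inr ⟨i, h2, h1⟩))

def G0 (n : ℕ) : Set (BF n) :=
  {g | (∃ b : Bool, g = fun _ => b) ∨ (∃ j, g = fun x => x j) ∨ ∃ j, g = fun x => !(x j)}

theorem CC_G0 (n : ℕ) : CC n (G0 n) := by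
  have h0 : CC 0 ({g | (∃ b : Bool, g = fun _ => b) ∨ (∃ j, g = fun x => x j)} : Set (BF n)) := by
    refine ⟨fun _ _ => false, by simp, ?_⟩
    rintro g (⟨b, rfl⟩ | ⟨j, rfl⟩)
    · exact ⟨Sum.inr (Sum.inl b), fun _ => rfl⟩
    · exact ⟨Sum.inl j, fun _ => rfl⟩
  have h1 := h0.many (c := 1) (List.finRange n) (fun j x => !(x j))
    (fun j => Cst.not (g := fun x => x j) (Or.inr ⟨j, rfl⟩))
  refine (h1.mono (by simp)).anti ?_
  rintro g (h | h | ⟨j, rfl⟩)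
  · exact Or.inl (Or.inl h)
  · exact Or.inl (Or.inr h)
  · exact Or.inr ⟨j, by simp, rfl⟩

theorem Cst_inF {G : Set (BF n)} (hG : G0 n ⊆ G) (d : Fin s → BF n) (hd : ∀ i, d i ∈ G)
    (A : Set (Fin n → Bool)) : Cst G (1 + 2 * n + s) (inF U P d A) := by
  have hb : ∀ b : Bool, (fun _ => b) ∈ G := fun b => hG (Or.inl ⟨b, rfl⟩)
  have h := Cst.orl (c := 0) (hb false) (inL U P d A) (by
    intro g hg
    apply Cst.of_mem
    simp only [inL, List.mem_cons, List.mem_append, List.mem_map, List.mem_finRange,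
      true_and] at hg
    rcases hg with rfl | ⟨j, rfl⟩ | ⟨j, rfl⟩ | ⟨i, rfl⟩
    · split_ifs
      exacts [hb _, hb _]
    · split_ifs
      exacts [hG (Or.inr (Or.inl ⟨j, rfl⟩)), hb _]
    · split_ifs
      exacts [hG (Or.inr (Or.inr ⟨j, rfl⟩)), hb _]
    · split_ifs
      exacts [hd i, hb _])
  refine Cst.mono h ?_
  simp [inL]
  omega

def DD : ℕ → Fin s → BF n
  | 0 => fun _ _ => false
  | t + 1 => fun i x => inF U P (DD t) (P i).1 x && inF U P (DD t) (P i).2 x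

theorem CC_DD (t : ℕ) : CC (n + t * (s * (2 * (1 + 2 * n + s) + 1)))
    (G0 n ∪ {g | ∃ i, g = DD U P t i}) := by
  induction t with
  | zero =>
    refine ((CC_G0 n).mono (by omega)).anti ?_
    rintro g (h | ⟨i, rfl⟩)
    · exact h
    · exact Or.inl ⟨false, rfl⟩
  | succ t ih =>
    have h1 := ih.many (List.finRange s) (DD U P (t + 1)) (fun i =>
      (Cst_inF U P (G := G0 n ∪ {g | ∃ i, g = DD U P t i}) Set.subset_union_left (DD U P t) (fun i => Or.inr ⟨i, rfl⟩) (P i).1).and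
      (Cst_inF U P (G := G0 n ∪ {g | ∃ i, g = DD U P t i}) Set.subset_union_left (DD U P t) (fun i => Or.inr ⟨i, rfl⟩) (P i).2))
    refine (h1.mono ?_).anti ?_
    · simp only [List.length_finRange]
      apply le_of_eq
      ring
    · rintro g (h | ⟨i, rfl⟩)
      · exact Or.inl (Or.inl h)
      · exact Or.inr ⟨i, by simp, rfl⟩

def outL (d : Fin s → BF n) : List (BF n) :=
  inF U P d ∅ ::
  ((List.finRange n).map (fun j x => inF U P d (litSet U j true) x && !(x j)) ++
  (List.finRange n).map (fun j x => inF U P d (litSet U j false) x && x j))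

def outF (d : Fin s → BF n) : BF n := orl (outL U P d)

theorem CC_out : CC (n + s * (s * (2 * (1 + 2 * n + s) + 1)) + (1 + 2 * n) * (1 + 2 * n + s + 2))
    {outF U P (DD U P s)} := by
  have h0 := CC_DD U P s
  set G := G0 n ∪ {g | ∃ i, g = DD U P s i}
  have hG : G0 n ⊆ G := Set.subset_union_left
  have hA : ∀ A, Cst G (1 + 2 * n + s) (inF U P (DD U P s) A) :=
    fun A => Cst_inF U P hG _ (fun i => Or.inr ⟨i, rfl⟩) A
  have h := Cst.orl (c := 1 + 2 * n + s + 1) (G := G) (hG (Or.inl ⟨false, rfl⟩))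
    (outL U P (DD U P s)) (by
    intro g hg
    simp only [outL, List.mem_cons, List.mem_append, List.mem_map, List.mem_finRange,
      true_and] at hg
    rcases hg with rfl | ⟨j, rfl⟩ | ⟨j, rfl⟩
    · exact (hA _).mono (by omega)
    · exact (hA _).and (Cst.of_mem (g := fun x => !(x j)) (hG (Or.inr (Or.inr ⟨j, rfl⟩))))
    · exact (hA _).and (Cst.of_mem (g := fun x => x j) (hG (Or.inr (Or.inl ⟨j, rfl⟩)))))
  refine ((h _ _ (le_refl _) h0).mono ?_).anti ?_
  · apply le_of_eq
    simp [outL]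
    ring
  · rintro g rfl
    exact Or.inl rfl

theorem outF_iff (d : Fin s → BF n) (x) : outF U P d x = true ↔
    inF U P d ∅ x = true ∨ ∃ j, inF U P d (litSet U j (!(x j))) x = true := by
  simp only [outF, orl, outL, List.any_cons, List.any_append, Bool.or_eq_true, List.any_eq_true,
    List.mem_map, List.mem_finRange, true_and, exists_exists_eq_and, Bool.and_eq_true,
    Bool.not_eq_true']
  constructor
  · rintro (h | ⟨j, h1, h2⟩ | ⟨j, h1, h2⟩)
    · exact Or.inl h
    · exact Or.inr ⟨j, by rw [h2]; exact h1⟩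
    · exact Or.inr ⟨j, by rw [h2]; exact h1⟩
  · rintro (h | ⟨j, h⟩)
    · exact Or.inl h
    · rcases hx : x j with _ | _
      · rw [hx] at h
        exact Or.inr (Or.inl ⟨j, h, hx⟩)
      · rw [hx] at h
        exact Or.inr (Or.inr ⟨j, h, hx⟩)

theorem inF_mono {d d' : Fin s → BF n} {x} (h : ∀ i, d i x = true → d' i x = true) {A B}
    (hAB : A ⊆ B) (hA : inF U P d A x = true) : inF U P d' B x = true := by
  rw [inF_iff] at hA ⊢
  rcases hA with hA | ⟨j, hA⟩ | ⟨i, h1, h2⟩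
  · exact Or.inl (hA.trans hAB)
  · exact Or.inr (Or.inl ⟨j, hA.trans hAB⟩)
  · exact Or.inr (Or.inr ⟨i, h i h1, h2.trans hAB⟩)

theorem DD_step {x} {t t' : ℕ} (h : ∀ i, DD U P t i x = true → DD U P t' i x = true) :
    ∀ i, DD U P (t + 1) i x = true → DD U P (t' + 1) i x = true := by
  intro i hi
  simp only [DD, Bool.and_eq_true] at hi ⊢
  exact ⟨inF_mono U P h (le_refl _) hi.1, inF_mono U P h (le_refl _) hi.2⟩

theorem DD_mono (x) (t : ℕ) : ∀ i, DD U P t i x = true → DD U P (t + 1) i x = true := by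
  induction t with
  | zero => intro i hi; simp [DD] at hi
  | succ t ih => exact DD_step U P ih

theorem DD_card (x) (t : ℕ) : (∀ i, DD U P (t + 1) i x = true → DD U P t i x = true) ∨
    t + 1 ≤ (Finset.univ.filter (fun i => DD U P (t + 1) i x = true)).card := by
  by_cases h : ∀ i, DD U P (t + 1) i x = true → DD U P t i x = true
  · exact Or.inl h
  right
  have hlt : (Finset.univ.filter (fun i => DD U P t i x = true)).card <
      (Finset.univ.filter (fun i => DD U P (t + 1) i x = true)).card := by
    apply Finset.card_lt_card
    push Not at h
    obtain ⟨i, h1, h2⟩ := h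
    rw [Finset.ssubset_iff_of_subset]
    · exact ⟨i, by simp [h1], by simp [h2]⟩
    · intro i hi
      simp only [Finset.mem_filter, Finset.mem_univ, true_and] at hi ⊢
      exact DD_mono U P x t i hi
  induction t with
  | zero => omega
  | succ t ih =>
    have h' : ¬ ∀ i, DD U P (t + 1) i x = true → DD U P t i x = true :=
      fun hh => h (DD_step U P hh)
    have hlt' : (Finset.univ.filter (fun i => DD U P t i x = true)).card <
      (Finset.univ.filter (fun i => DD U P (t + 1) i x = true)).card := by
      apply Finset.card_lt_card
      push Not at h'
      obtain ⟨i, h1, h2⟩ := h'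
      rw [Finset.ssubset_iff_of_subset]
      · exact ⟨i, by simp [h1], by simp [h2]⟩
      · intro i hi
        simp only [Finset.mem_filter, Finset.mem_univ, true_and] at hi ⊢
        exact DD_mono U P x t i hi
    have := ih h' hlt'
    omega

theorem DD_fix (x) : ∀ i, DD U P (s + 1) i x = true → DD U P s i x = true := by
  rcases DD_card U P x s with h | h
  · exact h
  · have := Finset.card_le_univ (Finset.univ.filter (fun i => DD U P (s + 1) i x = true))
    simp only [Fintype.card_fin] at this
    omega

theorem inF_sound {d : Fin s → BF n} {x} (hx : x ∈ U)
    (hd : ∀ i, d i x = true → x ∈ (P i).1 ∩ (P i).2) {A} (h : inF U P d A x = true) : x ∈ A := by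
  rw [inF_iff] at h
  rcases h with h | ⟨j, h⟩ | ⟨i, h1, h2⟩
  · exact h hx
  · exact h ⟨rfl, hx⟩
  · exact h2 (hd i h1)

theorem DD_sound {x} (hx : x ∈ U) (t : ℕ) :
    ∀ i, DD U P t i x = true → x ∈ (P i).1 ∩ (P i).2 := by
  induction t with
  | zero => intro i hi; simp [DD] at hi
  | succ t ih =>
    intro i hi
    simp only [DD, Bool.and_eq_true] at hi
    exact ⟨inF_sound U P hx ih hi.1, inF_sound U P hx ih hi.2⟩

end constr

theorem out_eq {n s : ℕ} (f : BF n) (P : Fin s → Set (Fin n → Bool) × Set (Fin n → Bool))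
    (hP : ∀ i, (P i).1 ⊆ zeros f ∧ (P i).2 ⊆ zeros f)
    (H : ∀ F, IsSemiFilter (zeros f) F → (∃ v, HasV (zeros f) F v ∧ v ∈ ones f) →
      ∃ i, CoversPair F (P i)) (x) : outF (zeros f) P (DD (zeros f) P s) x = f x := by
  rcases hfx : f x with _ | _
  · have hx : x ∈ zeros f := hfx
    have hs : ∀ A, inF (zeros f) P (DD (zeros f) P s) A x = true → x ∈ A :=
      fun A hA => inF_sound _ P hx (DD_sound _ P hx s) hA
    rw [← Bool.not_eq_true, outF_iff]
    rintro (h | ⟨j, h⟩)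
    · exact hs _ h
    · have := (hs _ h).1
      simp at this
  · by_contra hout
    rw [outF_iff] at hout
    push Not at hout
    obtain ⟨h0, hj⟩ := hout
    have hlit : ∀ j, inF (zeros f) P (DD (zeros f) P s) (litSet (zeros f) j (x j)) x = true :=
      fun j => (inF_iff _ _ _ _ _).2 (Or.inr (Or.inl ⟨j, le_refl _⟩))
    have hsub : ∀ j b, litSet (zeros f) j b ⊆ zeros f := fun j b => Set.inter_subset_right
    obtain ⟨i, h1, h2, h3⟩ := H {A | A ⊆ zeros f ∧ inF (zeros f) P (DD (zeros f) P s) A x = true}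
      ⟨fun A hA => hA.1, fun h => h0 h.2, ⟨le_refl _, (inF_iff _ _ _ _ _).2 (Or.inl (le_refl _))⟩,
        fun A B hA hAB hB => ⟨hB, inF_mono _ _ (fun _ h => h) hAB hA.2⟩⟩
      ⟨x, by
        intro j
        have a := hlit j
        have b := hj j
        rcases hx : x j with _ | _
        · rw [hx] at a b
          simp only [Bool.not_false] at b
          simp [hsub, a, b]
        · rw [hx] at a b
          simp only [Bool.not_true] at b
          simp [hsub, a, b], hfx⟩
    apply h3
    refine ⟨Set.inter_subset_left.trans (hP i).1, ?_⟩
    rw [inF_iff]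
    refine Or.inr (Or.inr ⟨i, DD_fix _ P x i ?_, le_refl _⟩)
    simp only [DD, Bool.and_eq_true]
    exact ⟨h1.2, h2.2⟩

theorem circ_of_cover {n s : ℕ} (hs : 1 ≤ s) (hn : n ≤ s) (f : BF n)
    (P : Fin s → Set (Fin n → Bool) × Set (Fin n → Bool))
    (hP : ∀ i, (P i).1 ⊆ zeros f ∧ (P i).2 ⊆ zeros f)
    (H : ∀ F, IsSemiFilter (zeros f) F → (∃ v, HasV (zeros f) F v ∧ v ∈ ones f) →
      ∃ i, CoversPair F (P i)) : ∃ C : Circuit n S3, C.size ≤ 30 * s ^ 3 ∧ C.Computes f := by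
  obtain ⟨C, h1, h2⟩ := (CC_out (zeros f) P).circuit rfl
  refine ⟨C, ?_, fun x => (h2 x).trans (out_eq f P hP H x)⟩
  rw [h1]
  calc _ ≤ s + s * (s * (2 * (s + 2 * s + s) + s)) + (s + 2 * s) * (s + 2 * s + s + 2 * s) := by
        gcongr
        omega
    _ = s + 9 * s ^ 3 + 18 * s ^ 2 := by ring
    _ ≤ s ^ 3 + 9 * s ^ 3 + 18 * s ^ 3 := by
        gcongr
        · exact Nat.le_self_pow (by norm_num) s
        · norm_num
    _ ≤ 30 * s ^ 3 := by omega

end Fus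

theorem stmt15 :
    ∃ K c : ℕ, ∀ (n : ℕ) (f : BF n) (s : ℕ), n ≤ s →
      (∀ C : Circuit n S3, C.size ≤ K * s ^ 3 → ¬ C.Computes f) →
      ∃ F0 : Set (Set (Set (Fin n → Bool))),
        (∀ F ∈ F0, IsSemiFilter (zeros f) F ∧ ∃ v, HasV (zeros f) F v ∧ v ∈ ones f) ∧
        F0.ncard ≤ 2 ^ (c * s * (zeros f).ncard) ∧
        (s : ℕ∞) ≤ rhoFus (zeros f) F0 := by
  refine ⟨30, 2, ?_⟩
  intro n f s hn hC
  rcases Nat.eq_zero_or_pos s with rfl | hs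
  · exact ⟨∅, by simp, by simp, by simp⟩
  have key : ∀ P : Fin s → Set (zeros f) × Set (zeros f), ∃ F, (IsSemiFilter (zeros f) F ∧
      ∃ v, HasV (zeros f) F v ∧ v ∈ ones f) ∧
      ∀ i, ¬ CoversPair F (Subtype.val '' (P i).1, Subtype.val '' (P i).2) := by
    intro P
    by_contra hcon
    push Not at hcon
    obtain ⟨C, h1, h2⟩ := Fus.circ_of_cover hs hn f
      (fun i => (Subtype.val '' (P i).1, Subtype.val '' (P i).2))
      (fun i => ⟨Subtype.coe_image_subset _ _, Subtype.coe_image_subset _ _⟩)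
      (fun F hF hv => hcon F ⟨hF, hv⟩)
    exact hC C h1 h2
  choose F hF hcov using key
  refine ⟨Set.range F, ?_, ?_, ?_⟩
  · rintro _ ⟨P, rfl⟩
    exact hF P
  · rw [← Set.image_univ]
    refine (Set.ncard_image_le Set.finite_univ).trans (le_of_eq ?_)
    rw [Set.ncard_univ, Nat.card_fun, Nat.card_prod]
    have : Nat.card (Set (zeros f)) = 2 ^ (zeros f).ncard := by
      rw [Nat.card_eq_fintype_card, Fintype.card_set, ← Nat.card_eq_fintype_card,
        Nat.card_coe_set_eq]
    rw [this, ← pow_add, ← pow_mul, Nat.card_fin]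
    congr 1
    ring
  · refine le_sInf ?_
    rintro t ⟨k, rfl, P, hP, hc⟩
    by_contra hlt
    have hk : k < s := by
      rw [not_le] at hlt
      exact_mod_cast hlt
    let Q : Fin s → Set (zeros f) × Set (zeros f) := fun i =>
      if h : i.val < k then (Subtype.val ⁻¹' (P ⟨i, h⟩).1, Subtype.val ⁻¹' (P ⟨i, h⟩).2)
      else (∅, ∅)
    obtain ⟨i, hi⟩ := hc (F Q) ⟨Q, rfl⟩
    apply hcov Q ⟨i.val, i.isLt.trans hk⟩
    have e1 : Q ⟨i.val, i.isLt.trans hk⟩ = (Subtype.val ⁻¹' (P i).1, Subtype.val ⁻¹' (P i).2) := by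
      simp only [Q]
      rw [dif_pos i.isLt]
    rw [e1]
    simp only [Subtype.image_preimage_coe]
    rw [Set.inter_eq_right.2 (hP i).1, Set.inter_eq_right.2 (hP i).2]
    exact hi

end
end

section
/- Let f ∈ ℱ_n with |V| ≥ 2 and let F₀ be a set of semi-filters F ⊆ 𝒫(U) with v(F) ∈ V containing two semi-filters F₁, F₂ with v(F₁) ≠ v(F₂). Set N := n + ⌈log₂|F₀|⌉, identify each y ∈ {0,1}^{N−n} with a semi-filter from F₀ (the y-th one, under some fixed surjective indexing), and for g ∈ ℱ_n define ḡ ∈ ℱ_N by ḡ(x,y) := g(x) if v(y) ≠ x, and ḡ(x,y) := y([[g]]) if v(y) = x. Let ℳ := {ḡ : g ∈ ℱ_n} with operations ∘̄(ḡ, h̄) := (g ∘ h)‾ for ∘ ∈ {∧₂, ∨₂}. Then: (i) the map g ↦ ḡ is injective, so the operations ∘̄ are well-defined; and (ii) ρ_asym(f′, ℳ) = ρ_{F₀}(f), where f′(x,y) := f(x). -/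
open scoped Classical ENNReal

noncomputable section

/-- The function `ḡ ∈ ℱ_N` on `{0,1}^n × {0,1}^{N-n}`:
`ḡ(x,y) = g(x)` if `v(y) ≠ x` and `ḡ(x,y) = y([[g]])` if `v(y) = x`,
where `y` is identified with the semi-filter `idx y` and `v(y) = vfun y`. -/
def barFn {n : ℕ} {Y : Type*} (U : Set (Fin n → Bool))
    (idx : Y → Set (Set (Fin n → Bool))) (vfun : Y → (Fin n → Bool))
    (g : BF n) : (Fin n → Bool) × Y → Bool :=
  fun p => if vfun p.2 = p.1 then decide (({x | g x = true} ∩ U) ∈ idx p.2) else g p.1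

/-- Binary connective coded by a Boolean: `false ↦ ∧₂`, `true ↦ ∨₂`. -/
def opApp (op : Bool) (a b : Bool) : Bool := if op then a || b else a && b

/-- Pointwise application of the coded connective to Boolean functions. -/
def opFn {n : ℕ} (op : Bool) (g h : BF n) : BF n := fun x => opApp op (g x) (h x)

/-- The positive error set `δ⁺_∘(ḡ, h̄) = ∘(ḡ, h̄) \ ∘̄(ḡ, h̄)` of the tuple
`T = (∘, g, h)`, with `∘̄(ḡ, h̄) := (g ∘ h)‾`. -/
def deltaPlus {n : ℕ} {Y : Type*} (U : Set (Fin n → Bool))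
    (idx : Y → Set (Set (Fin n → Bool))) (vfun : Y → (Fin n → Bool))
    (T : Bool × BF n × BF n) : Set ((Fin n → Bool) × Y) :=
  {p | opApp T.1 (barFn U idx vfun T.2.1 p) (barFn U idx vfun T.2.2 p) = true ∧
       barFn U idx vfun (opFn T.1 T.2.1 T.2.2) p = false}

/-- The negative error set `δ⁻_∘(ḡ, h̄) = ∘̄(ḡ, h̄) \ ∘(ḡ, h̄)`. -/
def deltaMinus {n : ℕ} {Y : Type*} (U : Set (Fin n → Bool))
    (idx : Y → Set (Set (Fin n → Bool))) (vfun : Y → (Fin n → Bool))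
    (T : Bool × BF n × BF n) : Set ((Fin n → Bool) × Y) :=
  {p | opApp T.1 (barFn U idx vfun T.2.1 p) (barFn U idx vfun T.2.2 p) = false ∧
       barFn U idx vfun (opFn T.1 T.2.1 T.2.2) p = true}

/-- Razborov's asymmetric distance `ρ_asym(f', ℳ)` for the model
`ℳ = {ḡ : g ∈ ℱ_n}` with operations `∘̄(ḡ, h̄) := (g ∘ h)‾`, `∘ ∈ {∧₂, ∨₂}`,
where `f'(x,y) := f(x)`: the minimal number of tuples `⟨∘, ḡ, h̄⟩` such that
`f' \ g₀ ⊆ ∪ δ⁺` and `g₀ \ f' ⊆ ∪ δ⁻` for some `g₀ ∈ ℳ`. -/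
def rhoAsym {n : ℕ} {Y : Type*} (f : BF n) (U : Set (Fin n → Bool))
    (idx : Y → Set (Set (Fin n → Bool))) (vfun : Y → (Fin n → Bool)) : ℕ∞ :=
  sInf {t : ℕ∞ | ∃ k : ℕ, t = (k : ℕ∞) ∧ ∃ g0 : BF n, ∃ T : Fin k → Bool × BF n × BF n,
    (∀ p : (Fin n → Bool) × Y, f p.1 = true → barFn U idx vfun g0 p = false →
      ∃ i, p ∈ deltaPlus U idx vfun (T i)) ∧
    (∀ p : (Fin n → Bool) × Y, barFn U idx vfun g0 p = true → f p.1 = false →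
      ∃ i, p ∈ deltaMinus U idx vfun (T i))}

end

noncomputable section

theorem aux16_hasV_unique {n : ℕ} {W : Set (Fin n → Bool)} {F : Set (Set (Fin n → Bool))}
    {v w : Fin n → Bool} (hv : HasV W F v) (hw : HasV W F w) : v = w := by
  funext i
  have h1 := (hv i).1
  have h2 := (hw i).1
  rw [Bool.eq_iff_iff, h1, h2]

theorem aux16_ne {n : ℕ} {Y : Type*} (U : Set (Fin n → Bool))
    (idx : Y → Set (Set (Fin n → Bool))) (vfun : Y → (Fin n → Bool))
    (g : BF n) (x : Fin n → Bool) (y : Y) (h : vfun y ≠ x) :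
    barFn U idx vfun g (x, y) = g x := by
  simp [barFn, h]

theorem aux16_eq {n : ℕ} {Y : Type*} (U : Set (Fin n → Bool))
    (idx : Y → Set (Set (Fin n → Bool))) (vfun : Y → (Fin n → Bool))
    (g : BF n) (y : Y) :
    barFn U idx vfun g (vfun y, y) = decide (({x | g x = true} ∩ U) ∈ idx y) := by
  simp [barFn]

theorem stmt16 {n : ℕ} (f : BF n) (hV : 2 ≤ (ones f).ncard)
    (F0 : Set (Set (Set (Fin n → Bool))))
    (hF0 : ∀ F ∈ F0, IsSemiFilter (zeros f) F ∧ ∃ v, HasV (zeros f) F v ∧ v ∈ ones f)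
    (hdiff : ∃ F1 ∈ F0, ∃ F2 ∈ F0, ∃ v1 v2 : Fin n → Bool,
      HasV (zeros f) F1 v1 ∧ HasV (zeros f) F2 v2 ∧ v1 ≠ v2)
    (idx : (Fin (Nat.clog 2 F0.ncard) → Bool) → Set (Set (Fin n → Bool)))
    (hidx : ∀ y, idx y ∈ F0)
    (hsurj : ∀ F ∈ F0, ∃ y, idx y = F)
    (vfun : (Fin (Nat.clog 2 F0.ncard) → Bool) → (Fin n → Bool))
    (hvfun : ∀ y, HasV (zeros f) (idx y) (vfun y)) :
    Function.Injective (barFn (zeros f) idx vfun) ∧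
    rhoAsym f (zeros f) idx vfun = rhoFus (zeros f) F0 := by
  have hy : ∀ x, ∃ y, vfun y ≠ x := by
    intro x
    obtain ⟨F1, h1, F2, h2, v1, v2, hv1, hv2, hne⟩ := hdiff
    obtain ⟨y1, rfl⟩ := hsurj F1 h1
    obtain ⟨y2, rfl⟩ := hsurj F2 h2
    have e1 := aux16_hasV_unique (hvfun y1) hv1
    have e2 := aux16_hasV_unique (hvfun y2) hv2
    by_cases hx : vfun y1 = x
    · refine ⟨y2, fun h => hne ?_⟩
      rw [← e1, ← e2, hx, h]
    · exact ⟨y1, hx⟩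
  have hfv : ∀ y, f (vfun y) = true := by
    intro y
    obtain ⟨_, v, hv, hvo⟩ := hF0 _ (hidx y)
    rw [aux16_hasV_unique (hvfun y) hv]
    exact hvo
  have hfe : ({x | f x = true} ∩ zeros f : Set (Fin n → Bool)) = ∅ := by
    ext x
    simp [zeros]
  refine ⟨?_, ?_⟩
  · intro g h hgh
    funext x
    obtain ⟨y, hyx⟩ := hy x
    have := congrFun hgh (x, y)
    rwa [aux16_ne _ _ _ _ _ _ hyx, aux16_ne _ _ _ _ _ _ hyx] at this
  · unfold rhoAsym rhoFus
    congr 1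
    ext t
    constructor
    · rintro ⟨k, rfl, g0, T, hp, hm⟩
      have hg : g0 = f := by
        funext x
        obtain ⟨y, hyx⟩ := hy x
        have hp' := hp (x, y)
        have hm' := hm (x, y)
        simp only [deltaPlus, deltaMinus, Set.mem_setOf_eq, aux16_ne _ _ _ _ _ _ hyx, opFn] at hp' hm'
        cases hf : f x <;> cases hg : g0 x <;> simp_all
      subst hg
      refine ⟨k, rfl, fun i => ({x | (T i).2.1 x = true} ∩ zeros g0,
        {x | (T i).2.2 x = true} ∩ zeros g0),
        fun i => ⟨Set.inter_subset_right, Set.inter_subset_right⟩, ?_⟩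
      intro F hF
      obtain ⟨y, rfl⟩ := hsurj F hF
      obtain ⟨⟨hsub, hemp, -, hmono⟩, -⟩ := hF0 _ hF
      obtain ⟨i, hi⟩ := hp (vfun y, y) (hfv y) (by
        rw [aux16_eq, hfe]; simpa using hemp)
      refine ⟨i, ?_⟩
      rcases hT : T i with ⟨op, g, h⟩
      simp only [hT] at hi ⊢
      simp only [deltaPlus, Set.mem_setOf_eq, aux16_eq] at hi
      obtain ⟨ha, hb⟩ := hi
      cases op
      · simp only [opApp, opFn, Bool.false_eq_true, if_false, Bool.and_eq_true,
          decide_eq_true_eq, decide_eq_false_iff_not] at ha hb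
        refine ⟨ha.1, ha.2, ?_⟩
        intro hc
        apply hb
        convert hc using 1
        ext x
        simp
        tauto
      · exfalso
        simp only [opApp, opFn, if_true, Bool.or_eq_true,
          decide_eq_true_eq, decide_eq_false_iff_not] at ha hb
        apply hb
        rcases ha with ha | ha
        · refine hmono _ _ ha ?_ Set.inter_subset_right
          rintro x ⟨h1, h2⟩
          exact ⟨Or.inl h1, h2⟩
        · refine hmono _ _ ha ?_ Set.inter_subset_right
          rintro x ⟨h1, h2⟩
          exact ⟨Or.inr h1, h2⟩
    · rintro ⟨k, rfl, P, hP, hc⟩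
      refine ⟨k, rfl, f, fun i => (false, fun x => decide (x ∈ (P i).1),
        fun x => decide (x ∈ (P i).2)), ?_, ?_⟩
      · rintro ⟨x, y⟩ hfx hb
        by_cases hxy : vfun y = x
        · subst hxy
          obtain ⟨i, h1, h2, h3⟩ := hc _ (hidx y)
          refine ⟨i, ?_⟩
          have e1 : {x | x ∈ (P i).1} ∩ zeros f = (P i).1 := Set.inter_eq_left.2 (hP i).1
          have e2 : {x | x ∈ (P i).2} ∩ zeros f = (P i).2 := Set.inter_eq_left.2 (hP i).2
          have e3 : {x | x ∈ (P i).1 ∧ x ∈ (P i).2} ∩ zeros f = (P i).1 ∩ (P i).2 :=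
            Set.inter_eq_left.2 (fun x hx => (hP i).1 hx.1)
          simp only [deltaPlus, Set.mem_setOf_eq, aux16_eq, opApp, opFn, Bool.false_eq_true,
            if_false, Bool.and_eq_true, decide_eq_true_eq, decide_eq_false_iff_not, e1, e2, e3]
          exact ⟨⟨h1, h2⟩, h3⟩
        · rw [aux16_ne _ _ _ _ _ _ hxy] at hb
          simp_all
      · rintro ⟨x, y⟩ hb hfx
        exfalso
        by_cases hxy : vfun y = x
        · subst hxy
          have := hfv y
          simp_all
        · rw [aux16_ne _ _ _ _ _ _ hxy] at hb
          simp_all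

end
end

section
/- There are absolute constants K and c such that for every sufficiently large n, every f ∈ ℱ_n, and every s with K^{1/7}·s ≥ n: if f is not computable by any Boolean circuit over {¬, ∧₂, ∨₂} of size at most K·s⁷, then there exist a set S ⊆ {0,1}^n with |S| ≤ s^c such that no circuit over {¬, ∧₂, ∨₂} of size at most s³ computes f on all of S, and a set F₀ of semi-filters F ⊆ 𝒫(U ∩ S) with v(F) ∈ V ∩ S such that |F₀| ≤ 2^{s^c} and ρ^S_{F₀}(f) ≥ s. -/
open scoped Classical ENNReal

noncomputable section

namespace FusProof

variable {n : ℕ}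

/-- ports available after a straight-line program with gate functions `L`. -/
def ports (L : List (BF n)) : Finset (BF n) :=
  L.toFinset ∪ (Finset.univ.image (fun i : Fin n => (fun x => x i : BF n)) ∪
    Finset.univ.image (fun b : Bool => (fun _ => b : BF n)))

def nxt (P : Finset (BF n)) : Finset (BF n) :=
  P.image (fun g x => !(g x)) ∪
    ((P ×ˢ P).image (fun p x => p.1 x && p.2 x) ∪ (P ×ˢ P).image (fun p x => p.1 x || p.2 x))

inductive SLP : List (BF n) → Prop
  | nil : SLP []
  | cons (L : List (BF n)) (g : BF n) : SLP L → g ∈ nxt (ports L) → SLP (g :: L)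

def Add (B : Set (BF n)) (m : ℕ) (T : Set (BF n)) : Prop :=
  ∀ L, SLP L → (∀ b ∈ B, b ∈ ports L) →
    ∃ L', SLP L' ∧ (∀ g ∈ ports L, g ∈ ports L') ∧ (∀ g ∈ T, g ∈ ports L') ∧
      L'.length ≤ L.length + m

theorem Add.mono {B B' T T' : Set (BF n)} {m m' : ℕ} (h : Add B m T) (hB : B ⊆ B')
    (hm : m ≤ m') (hT : T' ⊆ T) : Add B' m' T' := by
  intro L hL hb
  obtain ⟨L', h1, h2, h3, h4⟩ := h L hL (fun b hb' => hb b (hB hb'))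
  exact ⟨L', h1, h2, fun g hg => h3 g (hT hg), by omega⟩

theorem Add.base {B T : Set (BF n)} (h : T ⊆ B) : Add B 0 T := by
  intro L hL hb
  exact ⟨L, hL, fun _ h => h, fun g hg => hb g (h hg), by omega⟩

theorem Add.seq {B T T' : Set (BF n)} {m m' : ℕ} (h : Add B m T) (h' : Add (B ∪ T) m' T') :
    Add B (m + m') (T ∪ T') := by
  intro L hL hb
  obtain ⟨L1, a1, a2, a3, a4⟩ := h L hL hb
  obtain ⟨L2, b1, b2, b3, b4⟩ := h' L1 a1 (by
    rintro b (hb' | hb')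
    · exact a2 b (hb b hb')
    · exact a3 b hb')
  refine ⟨L2, b1, fun g hg => b2 g (a2 g hg), ?_, by omega⟩
  rintro g (hg | hg)
  · exact b2 g (a3 g hg)
  · exact b3 g hg

theorem Add.union {B T T' : Set (BF n)} {m m' : ℕ} (h : Add B m T) (h' : Add B m' T') :
    Add B (m + m') (T ∪ T') :=
  h.seq (h'.mono Set.subset_union_left le_rfl subset_rfl)

theorem Add.biUnion {ι : Type*} {B : Set (BF n)} {m : ℕ} (I : Finset ι) (T : ι → Set (BF n))
    (h : ∀ i ∈ I, Add B m (T i)) : Add B (I.card * m) (⋃ i ∈ I, T i) := by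
  induction I using Finset.induction_on with
  | empty => exact (Add.base (B := B) (T := ∅) (by simp)).mono subset_rfl (by simp) (by simp)
  | insert a I ha ih =>
    have h1 := (h a (by simp)).union (ih (fun i hi => h i (by simp [hi])))
    refine h1.mono subset_rfl ?_ ?_
    · rw [Finset.card_insert_of_notMem ha]; apply le_of_eq; ring
    · simp

theorem Add.step {B : Set (BF n)} {g : BF n} (hg : ∀ L : List (BF n), (∀ b ∈ B, b ∈ ports L) →
    g ∈ nxt (ports L)) : Add B 1 {g} := by
  intro L hL hb
  refine ⟨g :: L, SLP.cons L g hL (hg L hb), ?_, ?_, by simp⟩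
  · intro q hq
    simp only [ports, Finset.mem_union, List.mem_toFinset, List.mem_cons] at hq ⊢
    tauto
  · intro q hq
    simp only [Set.mem_singleton_iff] at hq
    subst hq
    simp [ports]

theorem Add.not {B : Set (BF n)} {g : BF n} (h : g ∈ B) : Add B 1 {fun x => !(g x)} := by
  apply Add.step
  intro L hL
  simp only [nxt, Finset.mem_union, Finset.mem_image]
  exact Or.inl ⟨g, hL g h, rfl⟩

theorem Add.and {B : Set (BF n)} {g g' : BF n} (h : g ∈ B) (h' : g' ∈ B) :
    Add B 1 {fun x => g x && g' x} := by
  apply Add.step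
  intro L hL
  simp only [nxt, Finset.mem_union, Finset.mem_image]
  exact Or.inr (Or.inl ⟨(g, g'), by simp [hL g h, hL g' h'], rfl⟩)

theorem Add.or {B : Set (BF n)} {g g' : BF n} (h : g ∈ B) (h' : g' ∈ B) :
    Add B 1 {fun x => g x || g' x} := by
  apply Add.step
  intro L hL
  simp only [nxt, Finset.mem_union, Finset.mem_image]
  exact Or.inr (Or.inr ⟨(g, g'), by simp [hL g h, hL g' h'], rfl⟩)

theorem Add.const {B : Set (BF n)} (b : Bool) : Add B 0 {fun _ => b} := by
  intro L hL hb
  refine ⟨L, hL, fun _ h => h, ?_, by omega⟩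
  intro g hg
  simp only [Set.mem_singleton_iff] at hg
  subst hg
  simp only [ports, Finset.mem_union, Finset.mem_image]
  exact Or.inr (Or.inr ⟨b, by simp, rfl⟩)

theorem Add.var {B : Set (BF n)} (i : Fin n) : Add B 0 {fun x => x i} := by
  intro L hL hb
  refine ⟨L, hL, fun _ h => h, ?_, by omega⟩
  intro g hg
  simp only [Set.mem_singleton_iff] at hg
  subst hg
  simp only [ports, Finset.mem_union, Finset.mem_image]
  exact Or.inr (Or.inl ⟨i, by simp, rfl⟩)

/-- final op: if `T` can be added then a function of `T` too -/
theorem Add.then {B T T' : Set (BF n)} {m m' : ℕ} (h : Add B m T) (h' : Add (B ∪ T) m' T') :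
    Add B (m + m') T' :=
  (h.seq h').mono subset_rfl le_rfl Set.subset_union_right

theorem Add.bigOr {B : Set (BF n)} (Q : Finset (BF n)) (hQ : ∀ q ∈ Q, q ∈ B) :
    Add B Q.card {fun x => decide (∃ q ∈ Q, q x = true)} := by
  induction Q using Finset.induction_on with
  | empty =>
    have : (fun x : Fin n → Bool => decide (∃ q ∈ (∅ : Finset (BF n)), q x = true))
      = fun _ => false := by funext x; simp
    rw [this]; exact (Add.const false)
  | insert a I ha ih =>
    rw [Finset.card_insert_of_notMem ha]
    refine (ih (fun q hq => hQ q (by simp [hq]))).then ?_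
    have : (fun x : Fin n → Bool => decide (∃ q ∈ insert a I, q x = true))
      = fun x => (a x || (fun x : Fin n → Bool => decide (∃ q ∈ I, q x = true)) x) := by
        funext x
        rw [Bool.eq_iff_iff]
        simp
    rw [this]
    exact Add.or (Or.inl (hQ a (by simp))) (Or.inr rfl)

/-! circuits to Add -/

def rdp (h : ℕ → BF n) {m : ℕ} (x : Fin n → Bool) : (Fin n ⊕ (Bool ⊕ Fin m)) → Bool
  | Sum.inl v => x v
  | Sum.inr (Sum.inl b) => b
  | Sum.inr (Sum.inr j) => h j.val x

theorem gateVal_eq (C : Circuit n S3) {i : ℕ} (h : i < C.size) (x : Fin n → Bool) :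
    C.gateVal x i = (C.conn ⟨i, h⟩).2
      (fun k => rdp (fun j x => C.gateVal x j) x (C.wires ⟨i, h⟩ k)) := by
  rw [Circuit.gateVal, dif_pos h]
  refine congrArg (C.conn ⟨i, h⟩).2 ?_
  funext k
  rcases C.wires ⟨i, h⟩ k with v | b | j <;> rfl

theorem ofCircuit (C : Circuit n S3) : Add ∅ C.size {C.eval} := by
  have key : ∀ m, m ≤ C.size → Add ∅ m {g | ∃ j < m, g = fun x => C.gateVal x j} := by
    intro m
    induction m with
    | zero => intro _; exact (Add.base (B := ∅) (T := ∅) (by simp)).mono (by simp) le_rfl (by simp)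
    | succ m ih =>
      intro hm
      have h1 := ih (by omega)
      have hlt : m < C.size := by omega
      have rd : ∀ w : Fin n ⊕ (Bool ⊕ Fin m),
          Add (∅ ∪ {g | ∃ j < m, g = fun x => C.gateVal x j}) 0
            {fun x => rdp (fun j x => C.gateVal x j) x w} := by
        intro w
        rcases w with v | b | j
        · exact Add.var v
        · exact Add.const b
        · apply Add.base
          rintro g rfl
          exact Or.inr ⟨j, j.isLt, rfl⟩
      have h2 : Add (∅ ∪ {g | ∃ j < m, g = fun x => C.gateVal x j}) 1
          {fun x => C.gateVal x m} := by
        have e : (fun x => C.gateVal x m) = fun x => (C.conn ⟨m, hlt⟩).2 (fun k =>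
            rdp (fun j x => C.gateVal x j) x (C.wires ⟨m, hlt⟩ k)) := by
          funext x
          exact gateVal_eq C hlt x
        rw [e]
        have hc := C.conn_mem ⟨m, hlt⟩
        generalize C.wires ⟨m, hlt⟩ = w
        revert w
        generalize C.conn ⟨m, hlt⟩ = cc at hc
        intro w
        rcases hc with rfl | rfl | rfl
        · have := (rd (w 0)).then (Add.not (Or.inr rfl))
          simpa using this
        · have := ((rd (w 0)).union (rd (w 1))).then
            (Add.and (Or.inr (Or.inl rfl)) (Or.inr (Or.inr rfl)))
          simpa using this
        · have := ((rd (w 0)).union (rd (w 1))).then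
            (Add.or (Or.inr (Or.inl rfl)) (Or.inr (Or.inr rfl)))
          simpa using this
      refine (h1.seq h2).mono subset_rfl le_rfl ?_
      rintro g ⟨j, hj, rfl⟩
      rcases Nat.lt_succ_iff_lt_or_eq.mp hj with h | h
      · exact Or.inl ⟨j, h, rfl⟩
      · subst h; exact Or.inr rfl
  have h := key C.size le_rfl
  have h2 : Add (∅ ∪ {g | ∃ j < C.size, g = fun x => C.gateVal x j}) 0 {C.eval} := by
    have e : C.eval = fun x => C.readPort x C.output := rfl
    rw [e]
    rcases C.output with v | b | j
    · exact Add.var v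
    · exact Add.const b
    · apply Add.base
      rintro g rfl
      exact Or.inr ⟨j, j.isLt, rfl⟩
  exact h.then h2

/-! Add to circuits -/

theorem exists_rdp {L : List (BF n)} {h : ℕ → BF n} (hh : ∀ g ∈ L, ∃ j < L.length, h j = g)
    {g : BF n} (hg : g ∈ ports L) :
    ∃ w : Fin n ⊕ (Bool ⊕ Fin L.length), ∀ x, g x = rdp h x w := by
  simp only [ports, Finset.mem_union, Finset.mem_image, List.mem_toFinset] at hg
  rcases hg with hg | ⟨i, -, rfl⟩ | ⟨b, -, rfl⟩
  · obtain ⟨j, hj, rfl⟩ := hh g hg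
    exact ⟨Sum.inr (Sum.inr ⟨j, hj⟩), fun x => rfl⟩
  · exact ⟨Sum.inl i, fun x => rfl⟩
  · exact ⟨Sum.inr (Sum.inl b), fun x => rfl⟩

theorem SLP.seq {L : List (BF n)} (hL : SLP L) : ∃ h : ℕ → BF n,
    (∀ i < L.length, ∃ c : Conn, c ∈ S3 ∧ ∃ w : Fin c.1 → (Fin n ⊕ (Bool ⊕ Fin i)),
      ∀ x, h i x = c.2 (fun k => rdp h x (w k))) ∧
    ∀ g ∈ L, ∃ j < L.length, h j = g := by
  induction hL with
  | nil => exact ⟨fun _ _ => false, by simp, by simp⟩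
  | cons L g hL hg ih =>
    obtain ⟨h, h1, h2⟩ := ih
    have hupd : ∀ (i : ℕ), i ≤ L.length → ∀ x (w : Fin n ⊕ (Bool ⊕ Fin i)),
        rdp (Function.update h L.length g) x w = rdp h x w := by
      intro i hi x w
      rcases w with v | b | j
      · rfl
      · rfl
      · have : (j : ℕ) ≠ L.length := by have := j.isLt; omega
        simp [rdp, Function.update_of_ne this]
    refine ⟨Function.update h L.length g, ?_, ?_⟩
    · intro i hi
      simp only [List.length_cons] at hi
      rcases Nat.lt_succ_iff_lt_or_eq.mp hi with hlt | heq
      · obtain ⟨c, hc, w, hw⟩ := h1 i hlt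
        refine ⟨c, hc, w, fun x => ?_⟩
        rw [Function.update_of_ne (by omega), hw]
        refine congrArg c.2 ?_
        funext k
        rw [hupd i (by omega)]
      · subst heq
        simp only [Function.update_self]
        simp only [nxt, Finset.mem_union, Finset.mem_image, Finset.mem_product] at hg
        rcases hg with ⟨q, hq, rfl⟩ | ⟨p, ⟨hp, hp'⟩, rfl⟩ | ⟨p, ⟨hp, hp'⟩, rfl⟩
        · obtain ⟨w, hw⟩ := exists_rdp h2 hq
          refine ⟨notConn, by simp [S3], fun _ => w, fun x => ?_⟩
          simp only [hupd _ le_rfl]; rw [hw]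
        · obtain ⟨w, hw⟩ := exists_rdp h2 hp
          obtain ⟨w', hw'⟩ := exists_rdp h2 hp'
          refine ⟨andConn, by simp [S3], ![w, w'], fun x => ?_⟩
          simp only [hupd _ le_rfl]; rw [hw, hw']
          simp
        · obtain ⟨w, hw⟩ := exists_rdp h2 hp
          obtain ⟨w', hw'⟩ := exists_rdp h2 hp'
          refine ⟨orConn, by simp [S3], ![w, w'], fun x => ?_⟩
          simp only [hupd _ le_rfl]; rw [hw, hw']
          simp
    · intro q hq
      simp only [List.mem_cons] at hq
      rcases hq with rfl | hq
      · exact ⟨L.length, by simp, by simp⟩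
      · obtain ⟨j, hj, rfl⟩ := h2 q hq
        exact ⟨j, by simp; omega, by rw [Function.update_of_ne (by omega)]⟩

theorem toCircuit {t : ℕ} {g : BF n} (h : Add ∅ t {g}) :
    ∃ C : Circuit n S3, C.size ≤ t ∧ ∀ x, C.eval x = g x := by
  obtain ⟨L, hL, -, hg, hlen⟩ := h [] SLP.nil (by simp)
  obtain ⟨h, h1, h2⟩ := hL.seq
  obtain ⟨o, ho⟩ := exists_rdp h2 (hg g rfl)
  choose c hc w hw using h1
  let C : Circuit n S3 := ⟨L.length, fun i => c i i.isLt, fun i => hc i i.isLt,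
    fun i => w i i.isLt, o⟩
  have key : ∀ i, i < L.length → ∀ x, C.gateVal x i = h i x := by
    intro i
    induction i using Nat.strong_induction_on with
    | _ i ih =>
      intro hi x
      rw [gateVal_eq C (show i < C.size from hi), hw i hi]
      refine congrArg (c i hi).2 ?_
      funext k
      show rdp (fun j x => C.gateVal x j) x (w i hi k) = _
      rcases w i hi k with v | b | j
      · rfl
      · rfl
      · exact ih j j.isLt (by have := j.isLt; omega) x
  refine ⟨C, by simpa using hlen, fun x => ?_⟩
  rw [ho]
  show C.readPort x o = _
  rcases o with v | b | j
  · rfl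
  · rfl
  · exact key j j.isLt x

/-! counting -/

theorem card_ports (L : List (BF n)) : (ports L).card ≤ L.length + (n + 2) := by
  unfold ports
  refine (Finset.card_union_le _ _).trans ?_
  refine Nat.add_le_add (List.toFinset_card_le L) ?_
  refine (Finset.card_union_le _ _).trans ?_
  refine Nat.add_le_add ?_ ?_
  · exact Finset.card_image_le.trans (by simp)
  · exact Finset.card_image_le.trans (by simp)

theorem card_nxt (P : Finset (BF n)) : (nxt P).card ≤ 3 * P.card ^ 2 := by
  unfold nxt
  refine (Finset.card_union_le _ _).trans ?_
  have h1 : (P.image (fun g x => !(g x) : BF n → BF n)).card ≤ P.card := Finset.card_image_le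
  have h2 := Finset.card_union_le ((P ×ˢ P).image (fun p x => p.1 x && p.2 x : BF n × BF n → BF n))
    ((P ×ˢ P).image (fun p x => p.1 x || p.2 x : BF n × BF n → BF n))
  have h3 : ((P ×ˢ P).image (fun p x => p.1 x && p.2 x : BF n × BF n → BF n)).card ≤ P.card ^ 2 :=
    Finset.card_image_le.trans (by simp [sq])
  have h4 : ((P ×ˢ P).image (fun p x => p.1 x || p.2 x : BF n × BF n → BF n)).card ≤ P.card ^ 2 :=
    Finset.card_image_le.trans (by simp [sq])
  have h5 : P.card ≤ P.card ^ 2 := Nat.le_self_pow (by norm_num) _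
  omega

def lists (n : ℕ) : ℕ → Finset (List (BF n))
  | 0 => {[]}
  | k + 1 => (lists n k).biUnion (fun L => (nxt (ports L)).image (fun g => g :: L))

theorem length_of_mem_lists : ∀ (k : ℕ) (L : List (BF n)), L ∈ lists n k → L.length = k := by
  intro k
  induction k with
  | zero => intro L hL; simp [lists] at hL; simp [hL]
  | succ k ih =>
    intro L hL
    simp only [lists, Finset.mem_biUnion, Finset.mem_image] at hL
    obtain ⟨L', h', g, -, rfl⟩ := hL
    simp [ih L' h']

theorem card_lists (N t : ℕ) (hN : t + (n + 2) ≤ N) : ∀ k ≤ t,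
    (lists n k).card ≤ (3 * N ^ 2) ^ k := by
  intro k
  induction k with
  | zero => intro _; simp [lists]
  | succ k ih =>
    intro hk
    rw [pow_succ]
    refine (Finset.card_biUnion_le_card_mul _ _ (3 * N ^ 2) ?_).trans
      (Nat.mul_le_mul_right _ (ih (by omega)))
    intro L hL
    refine Finset.card_image_le.trans ((card_nxt _).trans ?_)
    have := card_ports L
    have h2 := length_of_mem_lists k L hL
    gcongr
    omega

theorem SLP.mem_lists {L : List (BF n)} (hL : SLP L) : L ∈ lists n L.length := by
  induction hL with
  | nil => simp [lists]
  | cons L g hL hg ih =>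
    simp only [List.length_cons, lists, Finset.mem_biUnion, Finset.mem_image]
    exact ⟨L, ih, g, hg, rfl⟩

theorem count (n t N : ℕ) (hN : t + (n + 2) ≤ N) : ∃ G : Finset (BF n),
    (∀ g, Add ∅ t {g} ↔ g ∈ G) ∧ G.card ≤ (t + 1) * ((3 * N ^ 2) ^ t * N) := by
  have hfin : {g : BF n | Add ∅ t {g}} ⊆
      ((Finset.range (t + 1)).biUnion (fun k => (lists n k).biUnion ports) : Finset (BF n)) := by
    intro g hg
    obtain ⟨L, hL, -, hg', hlen⟩ := hg [] SLP.nil (by simp)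
    simp only [Finset.coe_biUnion, Set.mem_iUnion, Finset.mem_coe]
    refine ⟨L.length, by simp at hlen ⊢; omega, L, hL.mem_lists, hg' g rfl⟩
  refine ⟨Finset.univ.filter (fun g => Add ∅ t {g}), by simp, ?_⟩
  have : Finset.univ.filter (fun g : BF n => Add ∅ t {g}) ⊆
      (Finset.range (t + 1)).biUnion (fun k => (lists n k).biUnion ports) := by
    intro g hg
    exact_mod_cast hfin (by simpa using hg)
  refine (Finset.card_le_card this).trans ?_
  refine (Finset.card_biUnion_le_card_mul _ _ ((3 * N ^ 2) ^ t * N) ?_).trans (by simp)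
  intro k hk
  have hk : k ≤ t := by simp at hk; omega
  refine (Finset.card_biUnion_le_card_mul _ _ N ?_).trans ?_
  · intro L hL
    have := card_ports L
    have h2 := length_of_mem_lists k L hL
    omega
  · refine Nat.mul_le_mul_right _ ((card_lists N t hN k hk).trans ?_)
    exact Nat.pow_le_pow_right (by have : 0 < N := by omega
                                   positivity) hk

theorem greedy {X : Type*} (f : X → Bool) (G : Finset (X → Bool)) (M : ℕ)
    (hM : 1 ≤ M)
    (hno : ¬ ∃ R ⊆ G, R.Nonempty ∧ ∀ x, M * (R.filter (fun g => g x ≠ f x)).card ≤ R.card) :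
    ∀ j : ℕ, ∃ A : Finset X, A.card ≤ j ∧
      ((G.filter (fun g => ∀ x ∈ A, g x = f x)).card : ℝ) ≤ (1 - 1 / (M : ℝ)) ^ j * G.card := by
  intro j
  induction j with
  | zero => exact ⟨∅, by simp, by simp⟩
  | succ j ih =>
    obtain ⟨A, hA, hc⟩ := ih
    have hM' : (0 : ℝ) < M := by exact_mod_cast hM
    have h01 : (0 : ℝ) ≤ 1 - 1 / (M : ℝ) := by
      have : (1 : ℝ) ≤ M := by exact_mod_cast hM
      rw [sub_nonneg, div_le_one hM']; exact this
    set R := G.filter (fun g => ∀ x ∈ A, g x = f x) with hR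
    by_cases hne : R.Nonempty
    · have : ∃ x, R.card < M * (R.filter (fun g => g x ≠ f x)).card := by
        by_contra! hcon
        exact hno ⟨R, Finset.filter_subset _ _, hne, hcon⟩
      obtain ⟨x, hx⟩ := this
      refine ⟨insert x A, (Finset.card_insert_le _ _).trans (by omega), ?_⟩
      have hsub : G.filter (fun g => ∀ y ∈ insert x A, g y = f y) =
          R.filter (fun g => ¬ g x ≠ f x) := by
        ext g; simp [hR]; tauto
      have hsum := Finset.card_filter_add_card_filter_not (s := R) (fun g : X → Bool => g x ≠ f x)
      rw [hsub, pow_succ, mul_right_comm]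
      refine le_trans ?_ (mul_le_mul_of_nonneg_right hc h01)
      have h1 : ((R.filter (fun g => g x ≠ f x)).card : ℝ)
        + (R.filter (fun g => ¬ g x ≠ f x)).card = R.card := by exact_mod_cast hsum
      have h2 : (R.card : ℝ) ≤ M * (R.filter (fun g => g x ≠ f x)).card := by exact_mod_cast hx.le
      have h3 : (R.card : ℝ) / M ≤ (R.filter (fun g => g x ≠ f x)).card := by
        rw [div_le_iff₀ hM']; linarith
      have : (R.card : ℝ) * (1 - 1 / M) = R.card - R.card / M := by ring
      rw [this]; linarith
    · refine ⟨A, by omega, ?_⟩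
      rw [← hR, Finset.not_nonempty_iff_eq_empty.mp hne]
      simp only [Finset.card_empty, Nat.cast_zero]
      positivity

theorem antichecker {X : Type*} (f : X → Bool) (G : Finset (X → Bool)) (M q : ℕ)
    (hM : 1 ≤ M) (hq : 1 ≤ q) (hG : G.card ≤ 2 ^ q)
    (hno : ¬ ∃ R ⊆ G, R.Nonempty ∧ ∀ x, M * (R.filter (fun g => g x ≠ f x)).card ≤ R.card) :
    ∃ A : Finset X, A.card ≤ M * q ∧ ∀ g ∈ G, ∃ x ∈ A, g x ≠ f x := by
  obtain ⟨A, hA, hc⟩ := greedy f G M hM hno (M * q)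
  refine ⟨A, hA, ?_⟩
  have h1 : (1 - 1 / (M : ℝ)) ^ M ≤ Real.exp (-1) :=
    Real.one_sub_div_pow_le_exp_neg (by exact_mod_cast hM)
  have hM' : (0 : ℝ) < M := by exact_mod_cast hM
  have h01 : (0 : ℝ) ≤ 1 - 1 / (M : ℝ) := by
    have : (1 : ℝ) ≤ M := by exact_mod_cast hM
    rw [sub_nonneg, div_le_one hM']; exact this
  have h2 : Real.exp (-1) < 1 / 2 := by
    rw [Real.exp_neg, ← one_div]
    apply one_div_lt_one_div_of_lt (by norm_num)
    have := Real.exp_one_gt_d9; linarith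
  have h3 : (1 - 1 / (M : ℝ)) ^ (M * q) < (1 / 2) ^ q := by
    rw [pow_mul]
    exact pow_lt_pow_left₀ (h1.trans_lt h2) (by positivity) (by omega)
  have h4 : ((G.filter (fun g => ∀ x ∈ A, g x = f x)).card : ℝ) < 1 := by
    refine hc.trans_lt ?_
    rcases Nat.eq_zero_or_pos G.card with h0 | h0
    · simp [h0]
    · have hG' : (G.card : ℝ) ≤ 2 ^ q := by exact_mod_cast hG
      have h0' : (0 : ℝ) < G.card := by exact_mod_cast h0
      calc _ < (1 / 2 : ℝ) ^ q * G.card := by exact mul_lt_mul_of_pos_right h3 h0'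
        _ ≤ (1 / 2 : ℝ) ^ q * 2 ^ q := by gcongr
        _ = 1 := by rw [← mul_pow]; norm_num
  have h5 : (G.filter (fun g => ∀ x ∈ A, g x = f x)).card = 0 := by
    have : (G.filter (fun g => ∀ x ∈ A, g x = f x)).card < 1 := by exact_mod_cast h4
    omega
  rw [Finset.card_eq_zero, Finset.filter_eq_empty_iff] at h5
  intro g hg
  have := h5 hg
  push Not at this
  exact this

theorem avg {X : Type*} (f : X → Bool) (R : Finset (X → Bool)) (M : ℕ) (hne : R.Nonempty)
    (hR : ∀ x, M * (R.filter (fun g => g x ≠ f x)).card ≤ R.card) (U V : Finset X) (hV : V.Nonempty) :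
    ∃ g ∈ R, M * (U.filter (fun x => g x ≠ f x)).card ≤ 2 * U.card ∧
      M * (V.filter (fun x => g x ≠ f x)).card ≤ 2 * V.card := by
  have dbl : ∀ Y : Finset X, ∑ g ∈ R, M * (Y.filter (fun x => g x ≠ f x)).card ≤ R.card * Y.card := by
    intro Y
    rw [← Finset.mul_sum]
    have : ∑ g ∈ R, (Y.filter (fun x => g x ≠ f x)).card
        = ∑ x ∈ Y, (R.filter (fun g => g x ≠ f x)).card := by
      simp only [Finset.card_filter]
      exact Finset.sum_comm
    rw [this, Finset.mul_sum]
    refine (Finset.sum_le_card_nsmul Y _ R.card (fun x _ => hR x)).trans ?_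
    simp [mul_comm]
  rcases U.eq_empty_or_nonempty with hU | hU
  · subst hU
    obtain ⟨g, hg, h⟩ := Finset.exists_le_of_sum_le hne
      (f := fun g => M * (V.filter (fun x => g x ≠ f x)).card) (g := fun _ => V.card)
      (by simpa using dbl V)
    exact ⟨g, hg, by simp, by omega⟩
  · obtain ⟨g, hg, h⟩ := Finset.exists_le_of_sum_le hne
      (f := fun g => V.card * (M * (U.filter (fun x => g x ≠ f x)).card) +
        U.card * (M * (V.filter (fun x => g x ≠ f x)).card))
      (g := fun _ => 2 * (U.card * V.card))
      (by
        have h1 := Nat.mul_le_mul_left V.card (dbl U)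
        have h2 := Nat.mul_le_mul_left U.card (dbl V)
        rw [Finset.mul_sum] at h1 h2
        rw [Finset.sum_add_distrib]
        simp only [Finset.sum_const, smul_eq_mul]
        nlinarith)
    have hU' := hU.card_pos
    have hV' := hV.card_pos
    refine ⟨g, hg, ?_, ?_⟩
    · apply Nat.le_of_mul_le_mul_left _ hV'
      nlinarith [Nat.zero_le (U.card * (M * (V.filter (fun x => g x ≠ f x)).card))]
    · apply Nat.le_of_mul_le_mul_left _ hU'
      nlinarith [Nat.zero_le (V.card * (M * (U.filter (fun x => g x ≠ f x)).card))]

theorem inner_amp (f : BF n) (R : Finset (BF n)) (t : ℕ) (hne : R.Nonempty)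
    (hR : ∀ x, (4 * (n + 1)) * (R.filter (fun g => g x ≠ f x)).card ≤ R.card)
    (hA : ∀ g ∈ R, Add ∅ t {g}) (V : Finset (Fin n → Bool)) (hV : V.Nonempty)
    (hV1 : ∀ v ∈ V, f v = true) (j : ℕ) :
    ∃ h : BF n, Add ∅ (j * (t + 1)) {h} ∧
      2 ^ j * (Finset.univ.filter (fun u => f u = false ∧ h u = true)).card ≤ 2 ^ n ∧
      (4 * (n + 1)) * (V.filter (fun v => h v = false)).card ≤ 2 * j * V.card := by
  induction j with
  | zero =>
    refine ⟨fun _ => true, (Add.const true).mono subset_rfl (by simp) subset_rfl, ?_, by simp⟩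
    simp only [pow_zero, one_mul]
    refine (Finset.card_le_univ _).trans ?_
    simp
  | succ j ih =>
    obtain ⟨h, h1, h2, h3⟩ := ih
    set U := Finset.univ.filter (fun u => f u = false ∧ h u = true) with hU
    obtain ⟨g, hg, g1, g2⟩ := avg f R (4 * (n + 1)) hne hR U V hV
    refine ⟨fun x => h x && g x, ?_, ?_, ?_⟩
    · have := (h1.union (hA g hg)).then (Add.and (g := h) (g' := g) (Or.inr (Or.inl rfl))
        (Or.inr (Or.inr rfl)))
      exact this.mono subset_rfl (by apply le_of_eq; ring) subset_rfl
    · have e : Finset.univ.filter (fun u => f u = false ∧ (h u && g u) = true)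
          = U.filter (fun x => g x ≠ f x) := by
        ext x; simp only [hU, Finset.mem_filter, Finset.mem_univ, true_and, Bool.and_eq_true]
        constructor
        · rintro ⟨a, b, c⟩; exact ⟨⟨a, b⟩, by simp [a, c]⟩
        · rintro ⟨⟨a, b⟩, c⟩; exact ⟨a, b, by simpa [a] using c⟩
      rw [e]
      have : 2 * (U.filter (fun x => g x ≠ f x)).card ≤ U.card := by
        nlinarith [Nat.zero_le (n * (U.filter (fun x => g x ≠ f x)).card)]
      calc _ = 2 ^ j * (2 * (U.filter (fun x => g x ≠ f x)).card) := by ring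
        _ ≤ 2 ^ j * U.card := by gcongr
        _ ≤ _ := h2
    · have e : V.filter (fun v => (h v && g v) = false) ⊆
          V.filter (fun v => h v = false) ∪ V.filter (fun x => g x ≠ f x) := by
        intro x
        simp only [Finset.mem_filter, Finset.mem_union, Bool.and_eq_false_iff]
        rintro ⟨a, b | b⟩
        · exact Or.inl ⟨a, b⟩
        · exact Or.inr ⟨a, by simp [hV1 x a, b]⟩
      have := (Finset.card_le_card e).trans (Finset.card_union_le _ _)
      calc _ ≤ 4 * (n + 1) * ((V.filter (fun v => h v = false)).card +
            (V.filter (fun x => g x ≠ f x)).card) := by gcongr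
        _ ≤ _ := by rw [mul_add]; nlinarith

theorem inner_amp' (f : BF n) (R : Finset (BF n)) (t : ℕ) (hne : R.Nonempty)
    (hR : ∀ x, (4 * (n + 1)) * (R.filter (fun g => g x ≠ f x)).card ≤ R.card)
    (hA : ∀ g ∈ R, Add ∅ t {g}) (V : Finset (Fin n → Bool)) (hV : V.Nonempty)
    (hV1 : ∀ v ∈ V, f v = true) :
    ∃ h : BF n, Add ∅ ((n + 1) * (t + 1)) {h} ∧ (∀ u, f u = false → h u = false) ∧
      2 * (V.filter (fun v => h v = false)).card ≤ V.card := by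
  obtain ⟨h, h1, h2, h3⟩ := inner_amp f R t hne hR hA V hV hV1 (n + 1)
  refine ⟨h, h1, ?_, ?_⟩
  · have : (Finset.univ.filter (fun u => f u = false ∧ h u = true)).card = 0 := by
      by_contra hc
      have h4 : 1 ≤ (Finset.univ.filter (fun u => f u = false ∧ h u = true)).card := by omega
      have h5 := Nat.mul_le_mul_left (2 ^ (n + 1)) h4
      have : 0 < 2 ^ n := by positivity
      rw [pow_succ] at *
      omega
    rw [Finset.card_eq_zero, Finset.filter_eq_empty_iff] at this
    intro u hu
    have := this (Finset.mem_univ u)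
    simpa [hu] using this
  · apply Nat.le_of_mul_le_mul_left _ (show 0 < 2 * (n + 1) by omega)
    calc _ = 4 * (n + 1) * (V.filter (fun v => h v = false)).card := by ring
      _ ≤ _ := h3

theorem amplify (f : BF n) (R : Finset (BF n)) (t : ℕ) (hne : R.Nonempty)
    (hR : ∀ x, (4 * (n + 1)) * (R.filter (fun g => g x ≠ f x)).card ≤ R.card)
    (hA : ∀ g ∈ R, Add ∅ t {g}) : Add ∅ ((n + 1) * ((n + 1) * (t + 1) + 1)) {f} := by
  have key : ∀ j : ℕ, ∃ H : BF n, Add ∅ (j * ((n + 1) * (t + 1) + 1)) {H} ∧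
      (∀ u, f u = false → H u = false) ∧
      2 ^ j * (Finset.univ.filter (fun v => f v = true ∧ H v = false)).card ≤ 2 ^ n := by
    intro j
    induction j with
    | zero =>
      refine ⟨fun _ => false, (Add.const false).mono subset_rfl (by simp) subset_rfl, by simp, ?_⟩
      rw [pow_zero, one_mul]
      refine (Finset.card_le_univ _).trans ?_
      simp
    | succ j ih =>
      obtain ⟨H, h1, h2, h3⟩ := ih
      set V := Finset.univ.filter (fun v => f v = true ∧ H v = false) with hVdef
      rcases V.eq_empty_or_nonempty with hV | hV
      · refine ⟨H, h1.mono subset_rfl (Nat.mul_le_mul_right _ (by omega)) subset_rfl, h2, ?_⟩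
        rw [← hVdef, hV]; simp
      · obtain ⟨h, a1, a2, a3⟩ := inner_amp' f R t hne hR hA V hV (by simp [hVdef]; tauto)
        refine ⟨fun x => H x || h x, ?_, ?_, ?_⟩
        · have := (h1.union a1).then (Add.or (g := H) (g' := h) (Or.inr (Or.inl rfl))
            (Or.inr (Or.inr rfl)))
          exact this.mono subset_rfl (by apply le_of_eq; ring) subset_rfl
        · intro u hu; simp [h2 u hu, a2 u hu]
        · have e : Finset.univ.filter (fun v => f v = true ∧ (H v || h v) = false)
            = V.filter (fun v => h v = false) := by
            ext x; simp only [hVdef, Finset.mem_filter, Finset.mem_univ, true_and,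
              Bool.or_eq_false_iff]; tauto
          rw [e]
          calc _ = 2 ^ j * (2 * (V.filter (fun v => h v = false)).card) := by ring
            _ ≤ 2 ^ j * V.card := by gcongr
            _ ≤ _ := h3
  obtain ⟨H, h1, h2, h3⟩ := key (n + 1)
  have : H = f := by
    have : (Finset.univ.filter (fun u => f u = true ∧ H u = false)).card = 0 := by
      by_contra hc
      have h4 : 1 ≤ (Finset.univ.filter (fun u => f u = true ∧ H u = false)).card := by omega
      have h5 := Nat.mul_le_mul_left (2 ^ (n + 1)) h4
      have : 0 < 2 ^ n := by positivity
      rw [pow_succ] at *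
      omega
    rw [Finset.card_eq_zero, Finset.filter_eq_empty_iff] at this
    funext u
    have := this (Finset.mem_univ u)
    cases hu : f u
    · exact h2 u hu
    · simpa [hu] using this
  rw [← this]; exact h1

/-- derivability of `T` from the generators -/
def DD {k : ℕ} (W : Set (Fin n → Bool)) (P : Fin k → Set (Fin n → Bool) × Set (Fin n → Bool))
    (c : Fin k → BF n) (T : Set (Fin n → Bool)) : BF n := fun x =>
  decide (W ⊆ T ∨ (∃ j, litSet W j (x j) ⊆ T) ∨ ∃ i, c i x = true ∧ (P i).1 ∩ (P i).2 ⊆ T)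

def cc {k : ℕ} (W : Set (Fin n → Bool)) (P : Fin k → Set (Fin n → Bool) × Set (Fin n → Bool)) :
    ℕ → Fin k → BF n
  | 0 => fun _ _ => false
  | r + 1 => fun i x => DD W P (cc W P r) (P i).1 x && DD W P (cc W P r) (P i).2 x

def outF {k : ℕ} (W : Set (Fin n → Bool)) (P : Fin k → Set (Fin n → Bool) × Set (Fin n → Bool)) :
    BF n := fun x => decide (∃ j, DD W P (cc W P k) (litSet W j (!(x j))) x = true)

section
variable {k : ℕ} (W : Set (Fin n → Bool)) (P : Fin k → Set (Fin n → Bool) × Set (Fin n → Bool))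

def lits (n : ℕ) : Set (BF n) := {g | ∃ (j : Fin n) (b : Bool), g = fun x => x j == b}

theorem add_lits : Add ∅ n (lits n) := by
  have h := Add.biUnion (B := (∅ : Set (BF n))) (m := 1) (Finset.univ : Finset (Fin n))
    (fun j => {(fun x => x j : BF n)} ∪ {(fun x => !(x j) : BF n)}) (by
      intro j _
      have h1 : Add (∅ : Set (BF n)) 0 {fun x => x j} := Add.var j
      exact h1.seq (Add.not (Or.inr rfl)))
  refine h.mono subset_rfl (by simp) ?_
  rintro g ⟨j, b, rfl⟩
  simp only [Set.mem_iUnion]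
  refine ⟨j, Finset.mem_univ _, ?_⟩
  cases b
  · right; simp only [Set.mem_singleton_iff]; funext x; cases x j <;> rfl
  · left; simp only [Set.mem_singleton_iff]; funext x; cases x j <;> rfl

theorem add_DD (c : Fin k → BF n) (B : Set (BF n)) (hl : lits n ⊆ B) (hc : ∀ i, c i ∈ B)
    (T : Set (Fin n → Bool)) : Add B (2 * n + k + 1) {DD W P c T} := by
  by_cases hW : W ⊆ T
  · have : DD W P c T = fun _ => true := by funext x; simp [DD, hW]
    rw [this]
    exact (Add.const true).mono subset_rfl (by omega) subset_rfl
  let Q1 : Finset (BF n) := (Finset.univ.filter (fun p : Fin n × Bool => litSet W p.1 p.2 ⊆ T)).image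
    (fun p => fun x => x p.1 == p.2)
  let Q2 : Finset (BF n) := (Finset.univ.filter (fun i : Fin k => (P i).1 ∩ (P i).2 ⊆ T)).image c
  have h := Add.bigOr (B := B) (Q1 ∪ Q2) (by
    intro q hq
    simp only [Q1, Q2, Finset.mem_union, Finset.mem_image] at hq
    rcases hq with ⟨p, -, rfl⟩ | ⟨i, -, rfl⟩
    · exact hl ⟨p.1, p.2, rfl⟩
    · exact hc i)
  have e : (fun x => decide (∃ q ∈ Q1 ∪ Q2, q x = true)) = DD W P c T := by
    funext x
    rw [Bool.eq_iff_iff]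
    simp only [DD, decide_eq_true_eq, hW, false_or]
    constructor
    · rintro ⟨q, hq, hx⟩
      simp only [Q1, Q2, Finset.mem_union, Finset.mem_image, Finset.mem_filter, Finset.mem_univ,
        true_and] at hq
      rcases hq with ⟨p, hp, rfl⟩ | ⟨i, hi, rfl⟩
      · left
        refine ⟨p.1, ?_⟩
        have : x p.1 = p.2 := by simpa using hx
        rw [this]; exact hp
      · exact Or.inr ⟨i, hx, hi⟩
    · rintro (⟨j, hj⟩ | ⟨i, hi, hT⟩)
      · refine ⟨fun y => y j == x j, ?_, by simp⟩
        simp only [Q1, Finset.mem_union, Finset.mem_image, Finset.mem_filter, Finset.mem_univ,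
          true_and]
        exact Or.inl ⟨(j, x j), hj, rfl⟩
      · refine ⟨c i, ?_, hi⟩
        simp only [Q2, Finset.mem_union, Finset.mem_image, Finset.mem_filter, Finset.mem_univ,
          true_and]
        exact Or.inr ⟨i, hT, rfl⟩
  rw [e] at h
  refine h.mono subset_rfl ?_ subset_rfl
  have h1 : Q1.card ≤ 2 * n :=
    Finset.card_image_le.trans ((Finset.card_le_univ _).trans (by simp [mul_comm]))
  have h2 : Q2.card ≤ k := Finset.card_image_le.trans ((Finset.card_le_univ _).trans (by simp))
  have := Finset.card_union_le Q1 Q2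
  omega

theorem add_cc (r : ℕ) : Add (lits n) (r * (k * (2 * (2 * n + k + 1) + 1)))
    {g | ∃ i, g = cc W P r i} := by
  induction r with
  | zero =>
    refine (Add.const false).mono subset_rfl (by simp) ?_
    rintro g ⟨i, rfl⟩
    rfl
  | succ r ih =>
    rw [Nat.succ_mul]
    refine ih.then ?_
    have h := Add.biUnion (B := lits n ∪ {g | ∃ i, g = cc W P r i})
      (m := 2 * (2 * n + k + 1) + 1) (Finset.univ : Finset (Fin k))
      (fun i => {cc W P (r + 1) i}) (by
        intro i _
        have a := add_DD W P (cc W P r) (lits n ∪ {g | ∃ i, g = cc W P r i})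
          Set.subset_union_left (fun i => Or.inr ⟨i, rfl⟩)
        have := ((a (P i).1).union (a (P i).2)).then
          (Add.and (g := DD W P (cc W P r) (P i).1) (g' := DD W P (cc W P r) (P i).2)
            (Or.inr (Or.inl rfl)) (Or.inr (Or.inr rfl)))
        refine this.mono subset_rfl (by omega) ?_
        rintro g rfl
        rfl)
    refine h.mono subset_rfl (by simp) ?_
    rintro g ⟨i, rfl⟩
    simp only [Set.mem_iUnion]
    exact ⟨i, Finset.mem_univ _, rfl⟩

theorem add_out : Add ∅ (n + (k * (k * (2 * (2 * n + k + 1) + 1)) +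
    (2 * n * (2 * n + k + 2) + 2 * n))) {outF W P} := by
  refine add_lits.then ?_
  rw [Set.empty_union]
  refine (add_cc W P k).then ?_
  set B := lits n ∪ {g | ∃ i, g = cc W P k i} with hB
  let fn : Fin n × Bool → BF n := fun p x =>
    (x p.1 == !p.2) && DD W P (cc W P k) (litSet W p.1 p.2) x
  have h := Add.biUnion (B := B) (m := 2 * n + k + 2)
      (Finset.univ : Finset (Fin n × Bool)) (fun p => {fn p}) (by
        intro p _
        have a := add_DD W P (cc W P k) B
          Set.subset_union_left (fun i => Or.inr ⟨i, rfl⟩) (litSet W p.1 p.2)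
        exact a.then (Add.and (g := fun x => x p.1 == !p.2) (Or.inl (Or.inl ⟨p.1, !p.2, rfl⟩))
          (Or.inr rfl)))
  have hcard : (Finset.univ : Finset (Fin n × Bool)).card = 2 * n := by simp [mul_comm]
  rw [hcard] at h
  refine h.then ?_
  let Q : Finset (BF n) := Finset.univ.image fn
  have h2 := Add.bigOr (B := B ∪ ⋃ p ∈ (Finset.univ : Finset (Fin n × Bool)), {fn p}) Q (by
    intro q hq
    simp only [Q, Finset.mem_image] at hq
    obtain ⟨p, -, rfl⟩ := hq
    right
    simp only [Set.mem_iUnion]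
    exact ⟨p, Finset.mem_univ _, rfl⟩)
  have e : (fun x => decide (∃ q ∈ Q, q x = true)) = outF W P := by
    funext x
    rw [Bool.eq_iff_iff]
    simp only [outF, decide_eq_true_eq]
    constructor
    · rintro ⟨q, hq, hx⟩
      simp only [Q, Finset.mem_image] at hq
      obtain ⟨p, -, rfl⟩ := hq
      simp only [fn, Bool.and_eq_true, beq_iff_eq] at hx
      refine ⟨p.1, ?_⟩
      rw [hx.1, Bool.not_not]
      exact hx.2
    · rintro ⟨j, hj⟩
      refine ⟨fn (j, !(x j)), by simp [Q], ?_⟩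
      simp only [fn, Bool.not_not, beq_self_eq_true, Bool.true_and]
      exact hj
  rw [e] at h2
  exact h2.mono subset_rfl (Finset.card_image_le.trans hcard.le) subset_rfl

theorem DD_mono {c c' : Fin k → BF n} {x : Fin n → Bool} (h : ∀ i, c i x = true → c' i x = true)
    {T T' : Set (Fin n → Bool)} (hT : T ⊆ T') :
    DD W P c T x = true → DD W P c' T' x = true := by
  simp only [DD, decide_eq_true_eq]
  rintro (a | ⟨j, a⟩ | ⟨i, a, b⟩)
  · exact Or.inl (a.trans hT)
  · exact Or.inr (Or.inl ⟨j, a.trans hT⟩)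
  · exact Or.inr (Or.inr ⟨i, h i a, b.trans hT⟩)

theorem cc_mono_step (x : Fin n → Bool) (r : ℕ) :
    ∀ i, cc W P r i x = true → cc W P (r + 1) i x = true := by
  induction r with
  | zero => intro i h; simp [cc] at h
  | succ r ih =>
    intro i h
    rw [cc, Bool.and_eq_true] at h ⊢
    exact ⟨DD_mono W P ih subset_rfl h.1, DD_mono W P ih subset_rfl h.2⟩

theorem cc_congr (x : Fin n → Bool) {r r' : ℕ} (h : ∀ i, cc W P r i x = cc W P r' i x) (i : Fin k) :
    cc W P (r + 1) i x = cc W P (r' + 1) i x := by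
  simp only [cc, DD, h]

theorem cc_stable (x : Fin n → Bool) (i : Fin k) : cc W P (k + 1) i x = cc W P k i x := by
  let S : ℕ → Finset (Fin k) := fun r => Finset.univ.filter (fun i => cc W P r i x = true)
  have hS : Monotone S := monotone_nat_of_le_succ (fun r i hi => by
    simp only [S, Finset.mem_filter, Finset.mem_univ, true_and] at hi ⊢
    exact cc_mono_step W P x r i hi)
  have hiff : ∀ r r', S r = S r' → ∀ i, cc W P r i x = cc W P r' i x := by
    intro r r' h i
    rw [Bool.eq_iff_iff]
    have := Finset.ext_iff.mp h i
    simpa [S] using this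
  have h := Nat.stabilises_of_monotone (f := fun r => (S r).card) (b := k) (n := k + 1)
    (fun a b hab => Finset.card_le_card (hS hab))
    (fun m => (Finset.card_le_univ _).trans (by simp))
    (by
      intro m hm
      have h1 : S m = S (m + 1) := Finset.eq_of_subset_of_card_le (hS (by omega)) hm.ge
      have h2 := hiff _ _ h1
      have h3 : S (m + 1) = S (m + 2) := by
        ext i
        simp only [S, Finset.mem_filter, Finset.mem_univ, true_and]
        rw [cc_congr W P x h2 i]
      show (S (m + 1)).card = (S (m + 2)).card
      rw [h3]) (by omega)
  have h1 : S k = S (k + 1) := Finset.eq_of_subset_of_card_le (hS (by omega)) h.le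
  exact (hiff _ _ h1 i).symm

theorem DD_sound {x : Fin n → Bool} (hx : x ∈ W) {c : Fin k → BF n}
    (hc : ∀ i, c i x = true → x ∈ (P i).1 ∩ (P i).2) {T : Set (Fin n → Bool)}
    (h : DD W P c T x = true) : x ∈ T := by
  simp only [DD, decide_eq_true_eq] at h
  rcases h with a | ⟨j, a⟩ | ⟨i, a, b⟩
  · exact a hx
  · exact a ⟨rfl, hx⟩
  · exact b (hc i a)

theorem cc_sound {x : Fin n → Bool} (hx : x ∈ W) (r : ℕ) :
    ∀ i, cc W P r i x = true → x ∈ (P i).1 ∩ (P i).2 := by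
  induction r with
  | zero => intro i h; simp [cc] at h
  | succ r ih =>
    intro i h
    rw [cc, Bool.and_eq_true] at h
    exact ⟨DD_sound W P hx ih h.1, DD_sound W P hx ih h.2⟩

theorem out_zero {x : Fin n → Bool} (hx : x ∈ W) : outF W P x = false := by
  by_contra h
  rw [Bool.not_eq_false] at h
  simp only [outF, decide_eq_true_eq] at h
  obtain ⟨j, hj⟩ := h
  have := (DD_sound W P hx (cc_sound W P hx k) hj).1
  simp at this

theorem out_one (hn : 1 ≤ n) {v : Fin n → Bool}
    (hcov : ∀ F, IsSemiFilter W F → HasV W F v → ∃ i, CoversPair F (P i)) :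
    outF W P v = true := by
  by_contra hout
  rw [Bool.not_eq_true] at hout
  simp only [outF, decide_eq_false_iff_not] at hout
  push Not at hout
  let F : Set (Set (Fin n → Bool)) := {T | T ⊆ W ∧ DD W P (cc W P k) T v = true}
  have hpos : ∀ j, litSet W j (v j) ∈ F := by
    intro j
    refine ⟨Set.inter_subset_right, ?_⟩
    simp only [DD, decide_eq_true_eq]
    exact Or.inr (Or.inl ⟨j, subset_rfl⟩)
  have hneg : ∀ j, litSet W j (!(v j)) ∉ F := fun j h => hout j h.2
  have hsf : IsSemiFilter W F := by
    refine ⟨fun A hA => hA.1, ?_, ⟨subset_rfl, by simp [DD]⟩, ?_⟩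
    · intro h
      exact hout ⟨0, hn⟩ (DD_mono W P (fun _ h => h) (Set.empty_subset _) h.2)
    · intro A B hA hAB hB
      exact ⟨hB, DD_mono W P (fun _ h => h) hAB hA.2⟩
  have hv : HasV W F v := by
    intro i
    have h1 := hpos i
    have h2 := hneg i
    cases h : v i <;> simp [h] at h1 h2 <;> simp [h1, h2]
  obtain ⟨i, h1, h2, h3⟩ := hcov F hsf hv
  apply h3
  refine ⟨Set.inter_subset_left.trans h1.1, ?_⟩
  have : cc W P (k + 1) i v = true := by
    rw [cc, Bool.and_eq_true]; exact ⟨h1.2, h2.2⟩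
  rw [cc_stable] at this
  simp only [DD, decide_eq_true_eq]
  exact Or.inr (Or.inr ⟨i, this, subset_rfl⟩)

end

theorem fus_size {n s : ℕ} (hns : n ≤ s) (hs : 100 ≤ s) :
    n + (s * (s * (2 * (2 * n + s + 1) + 1)) + (2 * n * (2 * n + s + 2) + 2 * n)) ≤ s ^ 4 := by
  have h1 : n + (s * (s * (2 * (2 * n + s + 1) + 1)) + (2 * n * (2 * n + s + 2) + 2 * n)) ≤
      s + (s * (s * (2 * (2 * s + s + 1) + 1)) + (2 * s * (2 * s + s + 2) + 2 * s)) := by gcongr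
  refine h1.trans ?_
  obtain ⟨d, rfl⟩ := Nat.exists_eq_add_of_le hs
  ring_nf
  nlinarith [Nat.zero_le d, Nat.zero_le (d ^ 2), Nat.zero_le (d ^ 3), Nat.zero_le (d ^ 4)]

theorem amp_size {n s : ℕ} (hns : n ≤ s) (hs : 100 ≤ s) :
    (n + 1) * ((n + 1) * (s ^ 4 + 1) + 1) ≤ s ^ 7 := by
  have h1 : n + 1 ≤ 2 * s := by omega
  have h4 : 1 ≤ s ^ 4 := Nat.one_le_pow _ _ (by omega)
  have h5 : 1 ≤ s ^ 5 := Nat.one_le_pow _ _ (by omega)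
  calc (n + 1) * ((n + 1) * (s ^ 4 + 1) + 1) ≤ (2 * s) * ((2 * s) * (s ^ 4 + s ^ 4) + s ^ 5) := by
        gcongr
    _ = 10 * s ^ 6 := by ring
    _ ≤ s * s ^ 6 := by gcongr; omega
    _ = s ^ 7 := by ring

theorem count_size {s : ℕ} (hs : 100 ≤ s) :
    (s ^ 4 + 1) * ((3 * (s ^ 5) ^ 2) ^ (s ^ 4) * s ^ 5) ≤ 2 ^ (s ^ 7) := by
  have h4 : 1 ≤ s ^ 4 := Nat.one_le_pow _ _ (by omega)
  have hs2 : s ≤ 2 ^ s := Nat.lt_two_pow_self.le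
  have h1 : s ^ 4 + 1 ≤ s ^ 5 := by
    calc s ^ 4 + 1 ≤ 2 * s ^ 4 := by omega
      _ ≤ s * s ^ 4 := by gcongr; omega
      _ = s ^ 5 := by ring
  have h2 : 3 * (s ^ 5) ^ 2 ≤ s ^ 11 := by
    calc 3 * (s ^ 5) ^ 2 ≤ s * (s ^ 5) ^ 2 := by gcongr; omega
      _ = s ^ 11 := by ring
  have h3 : s * (11 * s ^ 4 + 10) ≤ s ^ 7 := by
    calc s * (11 * s ^ 4 + 10) ≤ s * (21 * s ^ 4) := by gcongr; omega
      _ ≤ s * ((s * s) * s ^ 4) := by gcongr; nlinarith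
      _ = s ^ 7 := by ring
  calc (s ^ 4 + 1) * ((3 * (s ^ 5) ^ 2) ^ (s ^ 4) * s ^ 5)
      ≤ s ^ 5 * ((s ^ 11) ^ (s ^ 4) * s ^ 5) := by gcongr
    _ = s ^ (11 * s ^ 4 + 10) := by rw [← pow_mul]; ring
    _ ≤ (2 ^ s) ^ (11 * s ^ 4 + 10) := by gcongr
    _ = 2 ^ (s * (11 * s ^ 4 + 10)) := by rw [pow_mul]
    _ ≤ _ := Nat.pow_le_pow_right (by norm_num) h3

theorem exists_A {n s : ℕ} (f : BF n) (hns : n ≤ s) (hs : 100 ≤ s)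
    (hf : ∀ C : Circuit n S3, C.size ≤ s ^ 7 → ¬ C.Computes f) :
    ∃ A : Finset (Fin n → Bool), A.card ≤ s ^ 9 ∧
      ∀ g, Add ∅ (s ^ 4) {g} → ∃ x ∈ A, g x ≠ f x := by
  have h4 : 1 ≤ s ^ 4 := Nat.one_le_pow _ _ (by omega)
  have hss : s ≤ s ^ 4 := Nat.le_self_pow (by norm_num) _
  obtain ⟨G, hG, hcard⟩ := count n (s ^ 4) (s ^ 5) (by
    calc s ^ 4 + (n + 2) ≤ 4 * s ^ 4 := by omega
      _ ≤ s * s ^ 4 := by gcongr; omega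
      _ = s ^ 5 := by ring)
  obtain ⟨A, hA, hA'⟩ := antichecker f G (4 * (n + 1)) (s ^ 7) (by omega)
    (Nat.one_le_pow _ _ (by omega)) (hcard.trans (count_size hs)) (by
      rintro ⟨R, hRG, hne, hR⟩
      have := amplify f R (s ^ 4) hne hR (fun g hg => (hG g).mpr (hRG hg))
      obtain ⟨C, hC, hC'⟩ := toCircuit this
      exact hf C (hC.trans (amp_size hns hs)) hC')
  refine ⟨A, hA.trans ?_, fun g hg => hA' g ((hG g).mp hg)⟩
  calc 4 * (n + 1) * s ^ 7 ≤ (s * s) * s ^ 7 := Nat.mul_le_mul_right _ (by nlinarith)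
    _ = s ^ 9 := by ring

end FusProof

theorem stmt17 :
    ∃ K c n0 : ℕ, ∀ (n : ℕ), n0 ≤ n → ∀ (f : BF n) (s : ℕ),
      (n : ℝ) ≤ (K : ℝ) ^ ((1 : ℝ) / 7) * s →
      (∀ C : Circuit n S3, C.size ≤ K * s ^ 7 → ¬ C.Computes f) →
      ∃ A : Set (Fin n → Bool), A.ncard ≤ s ^ c ∧
        (∀ C : Circuit n S3, C.size ≤ s ^ 3 → ∃ x ∈ A, C.eval x ≠ f x) ∧
        ∃ F0 : Set (Set (Set (Fin n → Bool))),
          (∀ F ∈ F0, IsSemiFilter (zeros f ∩ A) F ∧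
            ∃ v, HasV (zeros f ∩ A) F v ∧ v ∈ ones f ∩ A) ∧
          F0.ncard ≤ 2 ^ (s ^ c) ∧
          (s : ℕ∞) ≤ rhoFus (zeros f ∩ A) F0 := by
  refine ⟨1, 11, 100, ?_⟩
  intro n hn f s hns hf
  have hns : n ≤ s := by simpa using hns
  have hs : 100 ≤ s := hn.trans hns
  simp only [one_mul] at hf
  obtain ⟨A, hA, hanti⟩ := FusProof.exists_A f hns hs hf
  refine ⟨(A : Set (Fin n → Bool)), ?_, ?_, ?_⟩
  · rw [Set.ncard_coe_finset]
    exact hA.trans (Nat.pow_le_pow_right (by omega) (by norm_num))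
  · intro C hC
    have := (FusProof.ofCircuit C).mono subset_rfl
      (hC.trans (Nat.pow_le_pow_right (show 0 < s by omega) (show 3 ≤ 4 by norm_num))) subset_rfl
    exact hanti _ this
  set W : Set (Fin n → Bool) := zeros f ∩ (A : Set (Fin n → Bool)) with hW
  let Wf : Finset (Fin n → Bool) := A.filter (fun x => f x = false)
  have hWf : (Wf : Set (Fin n → Bool)) = W := by
    ext x; simp [Wf, hW, zeros, and_comm]
  -- for every tuple of pairs there is an uncovered semi-filter
  have key : ∀ P : Fin s → Set (Fin n → Bool) × Set (Fin n → Bool),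
      ∃ F, (IsSemiFilter W F ∧ ∃ v, HasV W F v ∧ v ∈ ones f ∩ (A : Set (Fin n → Bool))) ∧
        ∀ i, ¬ CoversPair F (P i) := by
    intro P
    by_contra hcon
    push Not at hcon
    have hadd := (FusProof.add_out W P).mono subset_rfl (FusProof.fus_size hns hs) subset_rfl
    obtain ⟨x, hxA, hx⟩ := hanti _ hadd
    apply hx
    cases hfx : f x
    · exact FusProof.out_zero W P ⟨hfx, hxA⟩
    · exact FusProof.out_one W P (by omega)
        (fun F h1 h2 => hcon F ⟨h1, x, h2, hfx, hxA⟩)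
  choose Φ hΦ hΦ' using key
  let I : Finset (Fin s → Finset (Fin n → Bool) × Finset (Fin n → Bool)) :=
    Fintype.piFinset (fun _ => Wf.powerset ×ˢ Wf.powerset)
  let F0 : Finset (Set (Set (Fin n → Bool))) :=
    I.image (fun p => Φ (fun i => ((p i).1, (p i).2)))
  refine ⟨(F0 : Set (Set (Set (Fin n → Bool)))), ?_, ?_, ?_⟩
  · intro F hF
    simp only [F0, Finset.coe_image, Set.mem_image] at hF
    obtain ⟨p, -, rfl⟩ := hF
    exact hΦ _
  · rw [Set.ncard_coe_finset]
    refine Finset.card_image_le.trans ?_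
    simp only [I, Fintype.card_piFinset, Finset.card_product, Finset.card_powerset,
      Finset.prod_const, Finset.card_univ, Fintype.card_fin]
    rw [← pow_add, ← pow_mul]
    apply Nat.pow_le_pow_right (by norm_num)
    have : Wf.card ≤ s ^ 9 := (Finset.card_filter_le _ _).trans hA
    calc (Wf.card + Wf.card) * s ≤ (s ^ 9 + s ^ 9) * s := by gcongr
      _ = 2 * s ^ 10 := by ring
      _ ≤ s * s ^ 10 := by gcongr; omega
      _ = s ^ 11 := by ring
  · unfold rhoFus
    apply le_sInf
    rintro t ⟨k, rfl, P, hP, hcov⟩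
    by_contra hlt
    rw [not_le, Nat.cast_lt] at hlt
    let p : Fin s → Finset (Fin n → Bool) × Finset (Fin n → Bool) := fun i =>
      if h : i.val < k then ((P ⟨i, h⟩).1.toFinset, (P ⟨i, h⟩).2.toFinset) else (∅, ∅)
    have hp : p ∈ I := by
      simp only [I, Fintype.mem_piFinset, Finset.mem_product, Finset.mem_powerset]
      intro i
      simp only [p]
      split_ifs with h
      · have := hP ⟨i, h⟩
        rw [← hWf] at this
        constructor
        · intro x hx; exact_mod_cast this.1 (by simpa using hx)
        · intro x hx; exact_mod_cast this.2 (by simpa using hx)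
      · simp
    obtain ⟨i, hi⟩ := hcov (Φ (fun i => ((p i).1, (p i).2))) (by
      simp only [F0, Finset.coe_image, Set.mem_image]
      exact ⟨p, hp, rfl⟩)
    apply hΦ' (fun i => ((p i).1, (p i).2)) ⟨i, i.isLt.trans hlt⟩
    have e : ((((p ⟨i, i.isLt.trans hlt⟩).1 : Set (Fin n → Bool)),
      ((p ⟨i, i.isLt.trans hlt⟩).2 : Set (Fin n → Bool)))) = P i := by
      simp [p]
    simp only [e]
    exact hi

end
end

section
/- There is an absolute constant K such that for every f ∈ ℱ_n and all d, n, t ≥ 2 and every s: if f is not computable by any circuit of depth at most 2d+1 and size at most K·d·(st+n)² over the connectives ∪_{a=2,…,s(t+2)+2n+2}{¬, ∧_a, ∨_a}, then ρ_{F_∀,d,t}(f) ≥ s, where F_∀ is the set of all (d−1)-semifilters F with v(F) ∈ V. -/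
open scoped Classical ENNReal

noncomputable section

namespace Fus

abbrev Port (n m : ℕ) := Fin n ⊕ (Bool ⊕ Fin m)

def evalP {n m : ℕ} (x : Fin n → Bool) (val : ℕ → Bool) : Port n m → Bool
  | Sum.inl v => x v
  | Sum.inr (Sum.inl b) => b
  | Sum.inr (Sum.inr j) => val j.val

def depthP {n m : ℕ} (dep : ℕ → ℕ) : Port n m → ℕ
  | Sum.inl _ => 0
  | Sum.inr (Sum.inl _) => 0
  | Sum.inr (Sum.inr j) => dep j.val

def castP {n m m' : ℕ} (h : m ≤ m') : Port n m → Port n m'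
  | Sum.inl v => Sum.inl v
  | Sum.inr (Sum.inl b) => Sum.inr (Sum.inl b)
  | Sum.inr (Sum.inr j) => Sum.inr (Sum.inr (Fin.castLE h j))

abbrev Gate (n m : ℕ) := Σ c : Conn, (Fin c.1 → Port n m)

def gate {n : ℕ} {S : Set Conn} (C : Circuit n S) (i : Fin C.size) : Gate n i.val :=
  ⟨C.conn i, C.wires i⟩

def evalG {n m : ℕ} (x : Fin n → Bool) (val : ℕ → Bool) (g : Gate n m) : Bool :=
  g.1.2 (fun k => evalP x val (g.2 k))

def depthG {n m : ℕ} (dep : ℕ → ℕ) (g : Gate n m) : ℕ :=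
  1 + Finset.univ.sup (fun k => depthP dep (g.2 k))

theorem gateVal_eq {n : ℕ} {S : Set Conn} (C : Circuit n S) (x : Fin n → Bool) (i : ℕ)
    (h : i < C.size) : C.gateVal x i = evalG x (C.gateVal x) (gate C ⟨i, h⟩) := by
  rw [Circuit.gateVal, dif_pos h]
  unfold evalG gate
  simp only
  refine congrArg (C.conn ⟨i, h⟩).2 (funext fun k => ?_)
  rcases C.wires ⟨i, h⟩ k with v | b | j <;> rfl

theorem gateDepth_eq {n : ℕ} {S : Set Conn} (C : Circuit n S) (i : ℕ)
    (h : i < C.size) : C.gateDepth i = depthG (C.gateDepth) (gate C ⟨i, h⟩) := by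
  rw [Circuit.gateDepth, dif_pos h]
  unfold depthG gate
  simp only
  congr 2
  funext k
  rcases C.wires ⟨i, h⟩ k with v | b | j <;> rfl

def addG {n : ℕ} {S : Set Conn} (C : Circuit n S) (g : Gate n C.size) (i : ℕ) : Gate n i :=
  if h : i < C.size then gate C ⟨i, h⟩ else
    ⟨g.1, fun k => castP (not_lt.mp h) (g.2 k)⟩

theorem addG_mem {n : ℕ} {S : Set Conn} (C : Circuit n S) (g : Gate n C.size) (hg : g.1 ∈ S)
    (i : ℕ) : (addG C g i).1 ∈ S := by
  unfold addG
  split_ifs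
  · exact C.conn_mem _
  · exact hg

def add {n : ℕ} {S : Set Conn} (C : Circuit n S) (g : Gate n C.size) (hg : g.1 ∈ S) :
    Circuit n S where
  size := C.size + 1
  conn i := (addG C g i.val).1
  conn_mem i := addG_mem C g hg i.val
  wires i := (addG C g i.val).2
  output := Sum.inr (Sum.inl false)

theorem evalP_congr {n m m' : ℕ} (h : m ≤ m') (x : Fin n → Bool) (v v' : ℕ → Bool)
    (hv : ∀ j < m, v' j = v j) (p : Port n m) : evalP x v' (castP h p) = evalP x v p := by
  rcases p with a | b | j
  · rfl
  · rfl
  · exact hv _ j.isLt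

theorem depthP_congr {n m m' : ℕ} (h : m ≤ m') (v v' : ℕ → ℕ)
    (hv : ∀ j < m, v' j = v j) (p : Port n m) : depthP v' (castP h p) = depthP v p := by
  rcases p with a | b | j
  · rfl
  · rfl
  · exact hv _ j.isLt

theorem castP_self {n m : ℕ} (p : Port n m) : castP le_rfl p = p := by
  rcases p with a | b | j <;> rfl

theorem add_val {n : ℕ} {S : Set Conn} (C : Circuit n S) (g : Gate n C.size) (hg : g.1 ∈ S)
    (x : Fin n → Bool) (i : ℕ) (hi : i < C.size) : (add C g hg).gateVal x i = C.gateVal x i := by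
  induction i using Nat.strong_induction_on with
  | _ i ih =>
    rw [gateVal_eq _ _ _ (show i < (add C g hg).size from Nat.lt_succ_of_lt hi), gateVal_eq _ _ _ hi]
    have : gate (add C g hg) ⟨i, Nat.lt_succ_of_lt hi⟩ = gate C ⟨i, hi⟩ := by
      show addG C g i = _
      unfold addG
      rw [dif_pos hi]
    rw [this]
    unfold evalG
    refine congrArg (gate C ⟨i, hi⟩).1.2 (funext fun k => ?_)
    have := evalP_congr le_rfl x _ _ (fun j hj => ih j hj (hj.trans hi)) ((gate C ⟨i, hi⟩).2 k)
    rwa [castP_self] at this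

theorem add_dep {n : ℕ} {S : Set Conn} (C : Circuit n S) (g : Gate n C.size) (hg : g.1 ∈ S)
    (i : ℕ) (hi : i < C.size) : (add C g hg).gateDepth i = C.gateDepth i := by
  induction i using Nat.strong_induction_on with
  | _ i ih =>
    rw [gateDepth_eq _ _ (show i < (add C g hg).size from Nat.lt_succ_of_lt hi), gateDepth_eq _ _ hi]
    have : gate (add C g hg) ⟨i, Nat.lt_succ_of_lt hi⟩ = gate C ⟨i, hi⟩ := by
      show addG C g i = _
      unfold addG
      rw [dif_pos hi]
    rw [this]
    unfold depthG
    congr 2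
    funext k
    have := depthP_congr le_rfl _ _ (fun j hj => ih j hj (hj.trans hi)) ((gate C ⟨i, hi⟩).2 k)
    rwa [castP_self] at this

theorem add_gate_last {n : ℕ} {S : Set Conn} (C : Circuit n S) (g : Gate n C.size)
    (hg : g.1 ∈ S) (h : C.size < (add C g hg).size) :
    gate (add C g hg) ⟨C.size, h⟩ = g := by
  show addG C g C.size = _
  unfold addG
  rw [dif_neg (lt_irrefl _)]
  simp only [castP_self]

theorem add_val_last {n : ℕ} {S : Set Conn} (C : Circuit n S) (g : Gate n C.size) (hg : g.1 ∈ S)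
    (x : Fin n → Bool) : (add C g hg).gateVal x C.size = evalG x (C.gateVal x) g := by
  rw [gateVal_eq _ _ _ (show C.size < (add C g hg).size from Nat.lt_succ_self _), add_gate_last]
  unfold evalG
  refine congrArg g.1.2 (funext fun k => ?_)
  have := evalP_congr le_rfl x _ _ (fun j hj => add_val C g hg x j hj) (g.2 k)
  rwa [castP_self] at this

theorem add_dep_last {n : ℕ} {S : Set Conn} (C : Circuit n S) (g : Gate n C.size) (hg : g.1 ∈ S) :
    (add C g hg).gateDepth C.size = depthG (C.gateDepth) g := by
  rw [gateDepth_eq _ _ (show C.size < (add C g hg).size from Nat.lt_succ_self _), add_gate_last]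
  unfold depthG
  congr 2
  funext k
  have := depthP_congr le_rfl _ _ (fun j hj => add_dep C g hg j hj) (g.2 k)
  rwa [castP_self] at this

/-- `C` has a port computing `g` at depth at most `D`. -/
def Has {n : ℕ} {S : Set Conn} (C : Circuit n S) (g : BF n) (D : ℕ) : Prop :=
  ∃ p : Port n C.size, (∀ x, evalP x (C.gateVal x) p = g x) ∧ depthP C.gateDepth p ≤ D

def Ext {n : ℕ} {S : Set Conn} (C C' : Circuit n S) : Prop := ∀ g D, Has C g D → Has C' g D

theorem Has.mono {n : ℕ} {S : Set Conn} {C : Circuit n S} {g : BF n} {D D' : ℕ}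
    (h : Has C g D) (hD : D ≤ D') : Has C g D' := by
  obtain ⟨p, h1, h2⟩ := h
  exact ⟨p, h1, h2.trans hD⟩

theorem has_const {n : ℕ} {S : Set Conn} (C : Circuit n S) (b : Bool) (D : ℕ) :
    Has C (fun _ => b) D := ⟨Sum.inr (Sum.inl b), fun _ => rfl, Nat.zero_le _⟩

theorem has_var {n : ℕ} {S : Set Conn} (C : Circuit n S) (i : Fin n) (D : ℕ) :
    Has C (fun x => x i) D := ⟨Sum.inl i, fun _ => rfl, Nat.zero_le _⟩

/-- `h` is one gate over functions available in `C` at depth `D`. -/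
def OneGate {n : ℕ} {S : Set Conn} (C : Circuit n S) (h : BF n) (D : ℕ) : Prop :=
  ∃ c ∈ S, ∃ gs : Fin c.1 → BF n, (∀ k, Has C (gs k) D) ∧ ∀ x, h x = c.2 (fun k => gs k x)

theorem OneGate.ext {n : ℕ} {S : Set Conn} {C C' : Circuit n S} (hE : Ext C C') {h : BF n} {D : ℕ}
    (hh : OneGate C h D) : OneGate C' h D := by
  obtain ⟨c, hc, gs, h1, h2⟩ := hh
  exact ⟨c, hc, gs, fun k => hE _ _ (h1 k), h2⟩

theorem add_one {n : ℕ} {S : Set Conn} (C : Circuit n S) (h : BF n) (D : ℕ) (hh : OneGate C h D) :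
    ∃ C' : Circuit n S, C'.size = C.size + 1 ∧ Ext C C' ∧ Has C' h (D + 1) := by
  obtain ⟨c, hc, gs, h1, h2⟩ := hh
  choose p hp1 hp2 using h1
  let g : Gate n C.size := ⟨c, p⟩
  refine ⟨add C g hc, rfl, ?_, ?_⟩
  · rintro f E ⟨q, hq1, hq2⟩
    refine ⟨castP (Nat.le_succ _) q, fun x => ?_, ?_⟩
    · rw [← hq1]
      exact evalP_congr _ x _ _ (fun j hj => add_val C g hc x j hj) q
    · refine le_trans (le_of_eq ?_) hq2
      exact depthP_congr _ _ _ (fun j hj => add_dep C g hc j hj) q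
  · refine ⟨Sum.inr (Sum.inr ⟨C.size, Nat.lt_succ_self _⟩), fun x => ?_, ?_⟩
    · show (add C g hc).gateVal x C.size = _
      rw [add_val_last, h2]
      unfold evalG
      show c.2 (fun k => evalP x (C.gateVal x) (p k)) = _
      simp only [hp1]
    · show (add C g hc).gateDepth C.size ≤ _
      rw [add_dep_last]
      unfold depthG
      have : Finset.univ.sup (fun k => depthP C.gateDepth (g.2 k)) ≤ D :=
        Finset.sup_le (fun k _ => hp2 k)
      omega

theorem add_fin {n : ℕ} {S : Set Conn} (D m : ℕ) : ∀ (C : Circuit n S) (h : Fin m → BF n)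
    (_ : ∀ i, OneGate C (h i) D),
    ∃ C' : Circuit n S, C'.size = C.size + m ∧ Ext C C' ∧ ∀ i, Has C' (h i) (D + 1) := by
  induction m with
  | zero => exact fun C h _ => ⟨C, rfl, fun _ _ h => h, fun i => i.elim0⟩
  | succ m ih =>
    intro C h hh
    obtain ⟨C1, hs1, hE1, hH1⟩ := ih C (fun i => h i.castSucc) (fun i => hh _)
    obtain ⟨C2, hs2, hE2, hH2⟩ := add_one C1 (h (Fin.last m)) D ((hh _).ext hE1)
    refine ⟨C2, by omega, fun g E hg => hE2 _ _ (hE1 _ _ hg), fun i => ?_⟩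
    refine Fin.lastCases ?_ (fun j => ?_) i
    · exact hH2
    · exact hE2 _ _ (hH1 j)

theorem add_fam {n : ℕ} {S : Set Conn} {ι : Type} [Fintype ι] (D : ℕ) (C : Circuit n S)
    (h : ι → BF n) (hh : ∀ i, OneGate C (h i) D) :
    ∃ C' : Circuit n S, C'.size = C.size + Fintype.card ι ∧ Ext C C' ∧
      ∀ i, Has C' (h i) (D + 1) := by
  let e := Fintype.equivFin ι
  obtain ⟨C', h1, h2, h3⟩ := add_fin D (Fintype.card ι) C (fun k => h (e.symm k)) (fun i => hh _)
  refine ⟨C', h1, h2, fun i => ?_⟩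
  have := h3 (e i)
  simpa using this

theorem oneGate_not {n R D : ℕ} (C : Circuit n (Sbdd R)) (g : BF n) (hg : Has C g D) :
    OneGate C (fun x => !(g x)) D :=
  ⟨notConn, Or.inl rfl, fun _ => g, fun _ => hg, fun _ => rfl⟩

theorem oneGate_or {n R D : ℕ} (hR : 2 ≤ R) (C : Circuit n (Sbdd R)) {ι : Type} [Fintype ι]
    (hc : Fintype.card ι ≤ R) (gs : ι → BF n) (hg : ∀ i, Has C (gs i) D)
    (h : BF n) (hh : ∀ x, h x = true ↔ ∃ i, gs i x = true) : OneGate C h D := by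
  let e := Fintype.equivFin ι
  refine ⟨bigOr R, Or.inr ⟨R, hR, le_rfl, Or.inr rfl⟩,
    fun k => if hk : k.val < Fintype.card ι then gs (e.symm ⟨k.val, hk⟩) else fun _ => false,
    fun k => ?_, fun x => ?_⟩
  · dsimp only
    split_ifs
    · exact hg _
    · exact has_const _ _ _
  · rw [Bool.eq_iff_iff, hh]
    simp only [decide_eq_true_eq]
    constructor
    · rintro ⟨i, hi⟩
      refine ⟨⟨(e i).val, (e i).isLt.trans_le hc⟩, ?_⟩
      rw [dif_pos (e i).isLt]
      simpa using hi
    · rintro ⟨k, hk⟩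
      split_ifs at hk with h1
      exact ⟨_, hk⟩

theorem oneGate_and {n R D : ℕ} (hR : 2 ≤ R) (C : Circuit n (Sbdd R)) {ι : Type} [Fintype ι]
    (hc : Fintype.card ι ≤ R) (gs : ι → BF n) (hg : ∀ i, Has C (gs i) D)
    (h : BF n) (hh : ∀ x, h x = true ↔ ∀ i, gs i x = true) : OneGate C h D := by
  let e := Fintype.equivFin ι
  refine ⟨bigAnd R, Or.inr ⟨R, hR, le_rfl, Or.inl rfl⟩,
    fun k => if hk : k.val < Fintype.card ι then gs (e.symm ⟨k.val, hk⟩) else fun _ => true,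
    fun k => ?_, fun x => ?_⟩
  · dsimp only
    split_ifs
    · exact hg _
    · exact has_const _ _ _
  · rw [Bool.eq_iff_iff, hh]
    simp only [decide_eq_true_eq]
    constructor
    · intro hi k
      split_ifs with h1
      · exact hi _
      · rfl
    · intro hk i
      have := hk ⟨(e i).val, (e i).isLt.trans_le hc⟩
      rw [dif_pos (e i).isLt] at this
      simpa using this

theorem has_circuit {n : ℕ} {S : Set Conn} (C : Circuit n S) (g : BF n) (D : ℕ) (h : Has C g D) :
    ∃ C' : Circuit n S, C'.size = C.size ∧ C'.depth ≤ D ∧ C'.Computes g := by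
  obtain ⟨p, h1, h2⟩ := h
  let C' : Circuit n S := { C with output := p }
  have hv : ∀ x i, C'.gateVal x i = C.gateVal x i := by
    intro x i
    induction i using Nat.strong_induction_on with
    | _ i ih =>
      by_cases hi : i < C.size
      · rw [gateVal_eq C _ _ hi, gateVal_eq C' _ _ hi]
        refine congrArg (C.conn ⟨i, hi⟩).2 (funext fun k => ?_)
        have := evalP_congr le_rfl x _ _ (fun j hj => ih j hj) ((gate C ⟨i, hi⟩).2 k)
        rwa [castP_self] at this
      · rw [Circuit.gateVal, Circuit.gateVal, dif_neg hi, dif_neg hi]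
  have hd : ∀ i, C'.gateDepth i = C.gateDepth i := by
    intro i
    induction i using Nat.strong_induction_on with
    | _ i ih =>
      by_cases hi : i < C.size
      · rw [gateDepth_eq C _ hi, gateDepth_eq C' _ hi]
        show 1 + _ = 1 + _
        congr 2
        funext k
        have := depthP_congr le_rfl _ _ (fun j hj => ih j hj) ((gate C ⟨i, hi⟩).2 k)
        rwa [castP_self] at this
      · rw [Circuit.gateDepth, Circuit.gateDepth, dif_neg hi, dif_neg hi]
  refine ⟨C', rfl, ?_, ?_⟩
  · have : C'.depth = depthP C'.gateDepth p := by
      clear hv hd h1 h2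
      rcases p with a | b | j <;> rfl
    rw [this, funext hd]
    exact h2
  · intro x
    rw [← h1]
    have : C'.eval x = evalP x (C'.gateVal x) p := by
      unfold Circuit.eval
      show C'.readPort x p = _
      rcases p with a | b | j <;> rfl
    rw [this, funext (hv x)]

/-- The generated family. -/
def FF {n a t : ℕ} {I : Type} (U : Set (Fin n → Bool)) (P : Fin a → Fin t → Set (Fin n → Bool))
    (S : I → Set (Fin n → Bool)) (x : Fin n → Bool) : ℕ → Set (Set (Fin n → Bool))
  | 0 => {A | A = U ∨ ∃ i, A = litSet U i (x i)}
  | k + 1 => {A | A ⊆ U ∧ ((∃ b, S b ∈ FF U P S x k ∧ S b ⊆ A) ∨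
      ∃ i, (⋂ j, P i j) ⊆ A ∧ ∀ j, P i j ∈ FF U P S x k)}

abbrev Idx (n a t : ℕ) := (Fin n × Bool) ⊕ ((Fin a × Fin t) ⊕ (Fin a ⊕ Unit))

def SS {n a t : ℕ} (U : Set (Fin n → Bool)) (P : Fin a → Fin t → Set (Fin n → Bool)) :
    Idx n a t → Set (Fin n → Bool)
  | Sum.inl p => litSet U p.1 p.2
  | Sum.inr (Sum.inl p) => P p.1 p.2
  | Sum.inr (Sum.inr (Sum.inl i)) => ⋂ j, P i j
  | Sum.inr (Sum.inr (Sum.inr _)) => ∅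

section
variable {n a t : ℕ} (U : Set (Fin n → Bool)) (P : Fin a → Fin t → Set (Fin n → Bool))
    (x : Fin n → Bool)

theorem FF_sub (k : ℕ) : ∀ A ∈ FF U P (SS U P) x k, A ⊆ U := by
  cases k with
  | zero =>
    rintro A (rfl | ⟨i, rfl⟩)
    · exact le_rfl
    · exact Set.inter_subset_right
  | succ k => exact fun A hA => hA.1

theorem FF_dom (hn : 2 ≤ n) (ht : 2 ≤ t) (hP : ∀ i j, P i j ⊆ U) (k : ℕ) :
    ∀ A ∈ FF U P (SS U P) x k, ∃ b, SS U P b ∈ FF U P (SS U P) x k ∧ SS U P b ⊆ A := by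
  cases k with
  | zero =>
    rintro A (rfl | ⟨i, rfl⟩)
    · exact ⟨Sum.inl (⟨0, by omega⟩, x ⟨0, by omega⟩), Or.inr ⟨_, rfl⟩, Set.inter_subset_right⟩
    · exact ⟨Sum.inl (i, x i), Or.inr ⟨_, rfl⟩, le_rfl⟩
  | succ k =>
    rintro A ⟨hA, ⟨b, hb, hbA⟩ | ⟨i, hi, hj⟩⟩
    · exact ⟨b, ⟨hbA.trans hA, Or.inl ⟨b, hb, le_rfl⟩⟩, hbA⟩
    · exact ⟨Sum.inr (Sum.inr (Sum.inl i)), ⟨hi.trans hA, Or.inr ⟨i, le_rfl, hj⟩⟩, hi⟩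

theorem FF_up (hn : 2 ≤ n) (ht : 2 ≤ t) (hP : ∀ i j, P i j ⊆ U) (k : ℕ)
    (A B : Set (Fin n → Bool)) (hB : B ∈ FF U P (SS U P) x k) (hBA : B ⊆ A) (hA : A ⊆ U) :
    A ∈ FF U P (SS U P) x (k + 1) := by
  obtain ⟨b, hb, hbB⟩ := FF_dom U P x hn ht hP k B hB
  exact ⟨hA, Or.inl ⟨b, hb, hbB.trans hBA⟩⟩

theorem FF_principal (hx : x ∈ U) (k : ℕ) : ∀ A ∈ FF U P (SS U P) x k, x ∈ A := by
  induction k with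
  | zero =>
    rintro A (rfl | ⟨i, rfl⟩)
    · exact hx
    · exact ⟨rfl, hx⟩
  | succ k ih =>
    rintro A ⟨hA, ⟨b, hb, hbA⟩ | ⟨i, hi, hj⟩⟩
    · exact hbA (ih _ hb)
    · exact hi (Set.mem_iInter.mpr fun j => ih _ (hj j))

end

theorem f_iff {n a t d : ℕ} (f : BF n) (P : Fin a → Fin t → Set (Fin n → Bool)) (hd : 2 ≤ d)
    (hn : 2 ≤ n) (ht : 2 ≤ t) (hP : ∀ i j, P i j ⊆ zeros f)
    (hcov : ∀ F ∈ {F | IsDSemifilter (zeros f) (d - 1) F ∧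
          ∃ v, HasV (zeros f) (F 0) v ∧ v ∈ ones f}, ∃ i, ∃ k, 1 ≤ k ∧ k < d ∧ KCovers F k (P i))
    (x : Fin n → Bool) :
    f x = true ↔ (∅ ∈ FF (zeros f) P (SS (zeros f) P) x (d - 1) ∨
      ∃ i, ∀ b, litSet (zeros f) i b ∈ FF (zeros f) P (SS (zeros f) P) x 0) := by
  constructor
  · intro hfx
    by_contra hcon
    push Not at hcon
    obtain ⟨h1, h2⟩ := hcon
    obtain ⟨i, k, hk1, hkd, hc1, hc2⟩ := hcov (FF (zeros f) P (SS (zeros f) P) x) (by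
      refine ⟨⟨fun k _ => FF_sub _ _ _ k, fun k _ A hA =>
        FF_up _ _ _ hn ht hP k A A hA le_rfl (FF_sub _ _ _ _ _ hA), h1, Or.inl rfl, ?_⟩, x, ?_, hfx⟩
      · intro k hk _ A B hB hBA hA
        obtain ⟨k, rfl⟩ : ∃ k', k = k' + 1 := ⟨k - 1, by omega⟩
        exact FF_up _ _ _ hn ht hP k A B hB hBA hA
      · intro i
        have h3 : litSet (zeros f) i (x i) ∈ FF (zeros f) P (SS (zeros f) P) x 0 :=
          Or.inr ⟨i, rfl⟩
        obtain ⟨b, hb⟩ := h2 i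
        cases hxi : x i <;> rw [hxi] at h3 <;> cases b <;> simp_all)
    obtain ⟨k, rfl⟩ : ∃ k', k = k' + 1 := ⟨k - 1, by omega⟩
    refine hc2 ⟨?_, Or.inr ⟨i, le_rfl, hc1⟩⟩
    exact (Set.iInter_subset _ ⟨0, by omega⟩).trans (hP i _)
  · intro h
    by_contra hfx
    have hx : x ∈ zeros f := by simpa [zeros] using hfx
    rcases h with h | ⟨i, hi⟩
    · exact FF_principal _ P x hx _ _ h
    · have h1 := (FF_principal _ P x hx _ _ (hi true)).1
      have h2 := (FF_principal _ P x hx _ _ (hi false)).1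
      simp only [Set.mem_ofPred_eq] at h1 h2
      rw [h1] at h2
      exact absurd h2 (by decide)

/-- membership as a Boolean function -/
def GG {n a t : ℕ} (U : Set (Fin n → Bool)) (P : Fin a → Fin t → Set (Fin n → Bool))
    (k : ℕ) (A : Set (Fin n → Bool)) : BF n := fun x => decide (A ∈ FF U P (SS U P) x k)

theorem GG_iff {n a t : ℕ} (U : Set (Fin n → Bool)) (P : Fin a → Fin t → Set (Fin n → Bool))
    (k : ℕ) (A : Set (Fin n → Bool)) (x : Fin n → Bool) :
    GG U P k A x = true ↔ A ∈ FF U P (SS U P) x k := decide_eq_true_iff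

theorem FF_zero {n a t : ℕ} (U : Set (Fin n → Bool)) (P : Fin a → Fin t → Set (Fin n → Bool))
    (A : Set (Fin n → Bool)) (x : Fin n → Bool) :
    A ∈ FF U P (SS U P) x 0 ↔ (A = U ∨ ∃ i, A = litSet U i (x i)) := Iff.rfl

theorem FF_succ {n a t : ℕ} (U : Set (Fin n → Bool)) (P : Fin a → Fin t → Set (Fin n → Bool))
    (k : ℕ) (A : Set (Fin n → Bool)) (x : Fin n → Bool) (hA : A ⊆ U) :
    A ∈ FF U P (SS U P) x (k + 1) ↔ ((∃ b, SS U P b ∈ FF U P (SS U P) x k ∧ SS U P b ⊆ A) ∨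
      ∃ i, (⋂ j, P i j) ⊆ A ∧ ∀ j, P i j ∈ FF U P (SS U P) x k) :=
  ⟨fun h => h.2, fun h => ⟨hA, h⟩⟩

theorem card_Idx (n a t : ℕ) : Fintype.card (Idx n a t) = 2 * n + a * t + a + 1 := by
  simp only [Fintype.card_sum, Fintype.card_prod, Fintype.card_fin, Fintype.card_bool,
    Fintype.card_unit]
  ring

theorem build0 {n a t R : ℕ} (U : Set (Fin n → Bool)) (P : Fin a → Fin t → Set (Fin n → Bool))
    (hn : 0 < n) (hR : 2 * n + 2 ≤ R) :
    ∃ C : Circuit n (Sbdd R), C.size = n + Fintype.card (Idx n a t) ∧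
      ∀ b, Has C (GG U P 0 (SS U P b)) 2 := by
  let C0 : Circuit n (Sbdd R) := ⟨0, fun i => i.elim0, fun i => i.elim0, fun i => i.elim0,
    Sum.inr (Sum.inl false)⟩
  obtain ⟨C1, h1, -, h3⟩ := add_fam 0 C0 (fun (i : Fin n) x => !(x i))
    (fun i => oneGate_not C0 _ (has_var _ _ _))
  obtain ⟨C2, h4, -, h6⟩ := add_fam 1 C1 (fun b => GG U P 0 (SS U P b)) (fun b =>
    oneGate_or (by omega) C1 (ι := Fin n × Bool) (by simp; omega)
      (fun p => if SS U P b = U then fun _ => true else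
        if SS U P b = litSet U p.1 p.2 then
          (if p.2 = true then fun x => x p.1 else fun x => !(x p.1)) else fun _ => false)
      (fun p => by
        split_ifs
        · exact has_const _ _ _
        · exact has_var _ _ _
        · exact h3 _
        · exact has_const _ _ _) _ (fun x => by
        rw [GG_iff, FF_zero]
        constructor
        · rintro (h | ⟨i, h⟩)
          · exact ⟨(⟨0, hn⟩, true), by simp [h]⟩
          · refine ⟨(i, x i), ?_⟩
            simp only [if_pos h]
            split_ifs with h1 h2
            · rfl
            · exact h2
            · simpa using h2
        · rintro ⟨⟨i, b⟩, h⟩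
          split_ifs at h with h1 h2 h3
          · exact Or.inl h1
          · refine Or.inr ⟨i, ?_⟩
            simp only at h2 h3 h
            rw [h, ← h3]; exact h2
          · refine Or.inr ⟨i, ?_⟩
            simp only [Bool.not_eq_true, Bool.not_eq_true'] at h2 h3 h
            rw [h, ← h3]; exact h2))
  refine ⟨C2, ?_, h6⟩
  rw [h4, h1, Fintype.card_fin]
  simp [C0]

theorem buildS {n a t R : ℕ} (U : Set (Fin n → Bool)) (P : Fin a → Fin t → Set (Fin n → Bool))
    (hR : a * (t + 2) + 2 * n + 2 ≤ R) (ht : t ≤ R) (hU : ∀ i j, P i j ⊆ U) (ht0 : 2 ≤ t)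
    (k D : ℕ) (C : Circuit n (Sbdd R))
    (hC : ∀ b, Has C (GG U P k (SS U P b)) D) :
    ∃ C' : Circuit n (Sbdd R), C'.size = C.size + (a + Fintype.card (Idx n a t)) ∧ Ext C C' ∧
      ∀ b, Has C' (GG U P (k + 1) (SS U P b)) (D + 2) := by
  obtain ⟨C1, h1, h2, h3⟩ := add_fam D C
    (fun (i : Fin a) x => decide (∀ j, P i j ∈ FF U P (SS U P) x k))
    (fun i => oneGate_and (by omega) C (ι := Fin t) (by simpa using ht)
      (fun j => GG U P k (P i j)) (fun j => hC (Sum.inr (Sum.inl (i, j)))) _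
      (fun x => by simp [GG]))
  have hsub : ∀ b, SS U P b ⊆ U := by
    rintro (p | p | i | _)
    · exact Set.inter_subset_right
    · exact hU _ _
    · exact (Set.iInter_subset _ ⟨0, by omega⟩).trans (hU i _)
    · exact Set.empty_subset _
  obtain ⟨C2, h4, h5, h6⟩ := add_fam (D + 1) C1 (fun b => GG U P (k + 1) (SS U P b)) (fun b =>
    oneGate_or (by omega) C1 (ι := Idx n a t ⊕ Fin a)
      (by rw [Fintype.card_sum, card_Idx, Fintype.card_fin]; nlinarith)
      (Sum.elim
        (fun c => if SS U P c ⊆ SS U P b then GG U P k (SS U P c) else fun _ => false)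
        (fun i => if (⋂ j, P i j) ⊆ SS U P b then
          fun x => decide (∀ j, P i j ∈ FF U P (SS U P) x k) else fun _ => false))
      (fun p => by
        rcases p with c | i <;> simp only [Sum.elim_inl, Sum.elim_inr] <;> split_ifs
        · exact (h2 _ _ (hC c)).mono (Nat.le_succ _)
        · exact has_const _ _ _
        · exact h3 _
        · exact has_const _ _ _) _ (fun x => by
        rw [GG_iff, FF_succ _ _ _ _ _ (hsub b)]
        refine Iff.trans ?_ Sum.exists.symm
        simp only [Sum.elim_inl, Sum.elim_inr]
        refine or_congr (exists_congr fun c => ?_) (exists_congr fun i => ?_)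
        · split_ifs with h <;> simp [h, GG_iff]
        · split_ifs with h <;> simp [h]))
  refine ⟨C2, ?_, fun g E h => h5 _ _ (h2 _ _ h), h6⟩
  rw [h4, h1, Fintype.card_fin]
  ring

theorem buildK {n a t R : ℕ} (U : Set (Fin n → Bool)) (P : Fin a → Fin t → Set (Fin n → Bool))
    (hR : a * (t + 2) + 2 * n + 2 ≤ R) (ht : t ≤ R) (hU : ∀ i j, P i j ⊆ U) (ht0 : 2 ≤ t)
    (hn : 0 < n) (k : ℕ) :
    ∃ C : Circuit n (Sbdd R), C.size = n + Fintype.card (Idx n a t) +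
        k * (a + Fintype.card (Idx n a t)) ∧
      (∀ b, Has C (GG U P 0 (SS U P b)) 2) ∧
      ∀ b, Has C (GG U P k (SS U P b)) (2 * k + 2) := by
  induction k with
  | zero =>
    obtain ⟨C, h1, h2⟩ := build0 U P (R := R) hn (by omega)
    exact ⟨C, by rw [h1]; ring, h2, h2⟩
  | succ k ih =>
    obtain ⟨C, h1, h2, h3⟩ := ih
    obtain ⟨C', h4, h5, h6⟩ := buildS U P hR ht hU ht0 k _ C h3
    exact ⟨C', by rw [h4, h1]; ring, fun b => h5 _ _ (h2 b), h6⟩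

theorem main {n a t d s : ℕ} (f : BF n) (P : Fin a → Fin t → Set (Fin n → Bool)) (hd : 2 ≤ d)
    (hn : 2 ≤ n) (ht : 2 ≤ t) (has : a < s) (hP : ∀ i j, P i j ⊆ zeros f)
    (hcov : ∀ F ∈ {F | IsDSemifilter (zeros f) (d - 1) F ∧
          ∃ v, HasV (zeros f) (F 0) v ∧ v ∈ ones f}, ∃ i, ∃ k, 1 ≤ k ∧ k < d ∧ KCovers F k (P i)) :
    ∃ C : Circuit n (Sbdd (s * (t + 2) + 2 * n + 2)),
        C.depth ≤ 2 * d + 1 ∧ C.size ≤ 10 * d * (s * t + n) ^ 2 ∧ C.Computes f := by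
  have hat : a * (t + 2) ≤ s * (t + 2) := Nat.mul_le_mul_right _ has.le
  have hst : t + 2 ≤ s * (t + 2) := Nat.le_mul_of_pos_left _ (by omega)
  obtain ⟨e, rfl⟩ : ∃ e, d = e + 1 := ⟨d - 1, by omega⟩
  obtain ⟨C, h1, h2, h3⟩ := buildK (R := s * (t + 2) + 2 * n + 2) (zeros f) P (by omega) (by omega)
    hP ht (by omega) e
  obtain ⟨C1, h4, h5, h6⟩ := add_fam 2 C
    (fun (i : Fin n) x => decide (∀ b, litSet (zeros f) i b ∈
      FF (zeros f) P (SS (zeros f) P) x 0))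
    (fun i => oneGate_and (by omega) C (ι := Bool) (by simp)
      (fun b => GG (zeros f) P 0 (litSet (zeros f) i b)) (fun b => h2 (Sum.inl (i, b))) _
      (fun x => by simp [GG]))
  obtain ⟨C2, h7, h8, h9⟩ := add_one C1 f (2 * e + 2)
    (oneGate_or (by omega) C1 (ι := Unit ⊕ Fin n) (by simp; omega)
      (Sum.elim (fun _ => GG (zeros f) P e ∅) (fun (i : Fin n) x =>
        decide (∀ b, litSet (zeros f) i b ∈ FF (zeros f) P (SS (zeros f) P) x 0)))
      (fun p => by
        rcases p with c | i
        · exact h5 _ _ (h3 (Sum.inr (Sum.inr (Sum.inr ()))))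
        · exact (h6 i).mono (by omega)) _ (fun x => by
        rw [f_iff f P hd hn ht hP hcov x]
        simp [GG]))
  obtain ⟨C3, h10, h11, h12⟩ := has_circuit C2 f _ h9
  refine ⟨C3, by omega, ?_, h12⟩
  rw [h10, h7, h4, h1, card_Idx, Fintype.card_fin]
  have hx : a * t ≤ s * t := Nat.mul_le_mul_right _ has.le
  have hy : 2 * s ≤ s * t := by nlinarith
  generalize hm : s * t + n = m
  have hm1 : a + (2 * n + a * t + a + 1) ≤ 4 * m := by omega
  have hm2 : n + (2 * n + a * t + a + 1) + n + 1 ≤ 5 * m := by omega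
  have hm3 : m ≤ m ^ 2 := by nlinarith
  have : e * (a + (2 * n + a * t + a + 1)) ≤ e * (4 * m) := Nat.mul_le_mul_left _ hm1
  nlinarith

end Fus

theorem stmt19 :
    ∃ K : ℕ, ∀ (n : ℕ) (f : BF n) (d t s : ℕ), 2 ≤ d → 2 ≤ n → 2 ≤ t →
      (∀ C : Circuit n (Sbdd (s * (t + 2) + 2 * n + 2)),
        C.depth ≤ 2 * d + 1 → C.size ≤ K * d * (s * t + n) ^ 2 → ¬ C.Computes f) →
      (s : ℕ∞) ≤ rhoDFus (zeros f) d t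
        {F | IsDSemifilter (zeros f) (d - 1) F ∧
          ∃ v, HasV (zeros f) (F 0) v ∧ v ∈ ones f} := by
  refine ⟨10, fun n f d t s hd hn ht h => ?_⟩
  refine le_sInf ?_
  rintro r ⟨a, rfl, P, hP, hcov⟩
  by_contra hlt
  have has : a < s := by
    rw [not_le] at hlt
    exact_mod_cast hlt
  obtain ⟨C, h1, h2, h3⟩ := Fus.main f P hd hn ht has hP hcov
  exact h C h1 h2 h3

end
end
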